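/- arXiv:math/0702352 — 2 statements merged into one kernel-verified Lean document; each statement's English description precedes it below -/
import Mathlib

section
/- Let P be a hereditary property of ordered graphs and k ∈ ℕ, and suppose that there are ordered graphs G ∈ P for which t_{k+1}, the size of the (k+1)-st largest homogeneous block of G, is arbitrarily large. Then |P_n| ≥ C(n-3k-2, k) for every n ∈ ℕ (so |P_n| ≥ n^k/k! + O(n^{k-1}) as n → ∞), and moreover if k = 1 then |P_n| ≥ n for every n ∈ ℕ. -/
open Finset

/-- `IndSub G H` : `G` is an induced ordered subgraph of `H`, i.e. there is an
order-preserving injection of the vertices preserving adjacency and non-adjacency. -/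
def IndSub {m n : ℕ} (G : SimpleGraph (Fin m)) (H : SimpleGraph (Fin n)) : Prop :=
  ∃ φ : Fin m ↪o Fin n, ∀ i j : Fin m, G.Adj i j ↔ H.Adj (φ i) (φ j)

/-- A hereditary property of ordered graphs: a family of ordered graphs (one set of
graphs on `[n]` for each `n`), closed under taking induced ordered subgraphs.  (Closure
under order-preserving isomorphisms is automatic in this encoding, since the only
order-preserving bijection of `Fin n` is the identity.) -/
structure HerProp where
  mem : ∀ n : ℕ, Set (SimpleGraph (Fin n))
  hered : ∀ {m n : ℕ} (G : SimpleGraph (Fin m)) (H : SimpleGraph (Fin n)),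
    IndSub G H → H ∈ mem n → G ∈ mem m

/-- The speed of a property: `n ↦ |P_n|`. -/
noncomputable def speed (P : HerProp) (n : ℕ) : ℕ := (P.mem n).ncard

/-- Generalized Fibonacci numbers `F_{n,k}` of order `k`:
`F_{0,k} = 1`, `F_{n,k} = F_{n-1,k} + ⋯ + F_{n-k,k}` (terms with negative index are 0). -/
def genFib (k : ℕ) : ℕ → ℕ
  | 0 => 1
  | n + 1 => ∑ i ∈ Finset.range k, if i ≤ n then genFib k (n - i) else 0
decreasing_by omega

/-- `lHom G ℓ x y` : vertices `x` and `y` are `ℓ`-homogeneous in `G`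
(`x ∼_ℓ y`), i.e. they have the same neighbourhoods outside `N_ℓ(x) ∪ N_ℓ(y)`. -/
def lHom {N : ℕ} (G : SimpleGraph (Fin N)) (ℓ : ℕ) (x y : Fin N) : Prop :=
  ∀ v : Fin N, ℓ ≤ ((v : ℤ) - (x : ℤ)).natAbs → ℓ ≤ ((v : ℤ) - (y : ℤ)).natAbs →
    (G.Adj x v ↔ G.Adj y v)

/-- `G` contains a `k`-structure of Type 1. -/
def HasType1 {N : ℕ} (G : SimpleGraph (Fin N)) (k : ℕ) : Prop :=
  ∃ (y : Fin N) (x : Fin (2 * k) → Fin N), StrictMono x ∧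
    ((∀ i, y < x i) ∨ (∀ i, x i < y)) ∧
    ∀ i j : Fin (2 * k), (j : ℕ) = (i : ℕ) + 1 → (G.Adj y (x i) ↔ ¬ G.Adj y (x j))

/-- `G` contains a `k`-structure of Type 2 (2(a) or 2(b)). -/
def HasType2 {N : ℕ} (G : SimpleGraph (Fin N)) (k : ℕ) : Prop :=
  ∃ x y : Fin (2 * k) → Fin N, StrictMono x ∧ (StrictMono y ∨ StrictAnti y) ∧
    (∀ i j, x i < y j) ∧
    ∀ i j : Fin (2 * k), (j : ℕ) = (i : ℕ) + 1 → (G.Adj (x i) (y i) ↔ ¬ G.Adj (x j) (y j))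

/-- `G` contains a `(k,ℓ)`-structure of Type 3. -/
def HasType3 {N : ℕ} (G : SimpleGraph (Fin N)) (k ℓ : ℕ) : Prop :=
  ∃ (x y : Fin (2 * k) → Fin N) (z : Fin (2 * k) → Fin (ℓ - 1) → Fin N),
    (∀ i t, x i < z i t) ∧ (∀ i, StrictMono (z i)) ∧ (∀ i t, z i t < y i) ∧
    (∀ i, x i < y i) ∧
    (∀ i j : Fin (2 * k), (j : ℕ) = (i : ℕ) + 1 → y i < x j) ∧
    ∀ i j : Fin (2 * k), (j : ℕ) = (i : ℕ) + 1 → (G.Adj (x i) (y i) ↔ ¬ G.Adj (x j) (y j))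

/-- `S_n(G)` : the number of pairwise non-isomorphic (as ordered graphs) induced ordered
subgraphs of `G` of order `n`. -/
noncomputable def numSub {N : ℕ} (G : SimpleGraph (Fin N)) (n : ℕ) : ℕ :=
  {H : SimpleGraph (Fin n) | IndSub H G}.ncard
/-- The ordered graph `M^<_I(X,Y)` with `|X| = |Y| = m` (vertices `0,…,m-1` playing the
role of `x_1 < … < x_m` and vertices `m,…,2m-1` the role of `y_1 < … < y_m`). -/
def Mlt (m : ℕ) (I1 I2 I3 I4 : Bool) : SimpleGraph (Fin (2 * m)) :=
  SimpleGraph.fromRel (fun u v =>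
    ((u : ℕ) < m ∧ (v : ℕ) < m ∧ I1 = true) ∨
    (m ≤ (u : ℕ) ∧ m ≤ (v : ℕ) ∧ I4 = true) ∨
    ((u : ℕ) < m ∧ m ≤ (v : ℕ) ∧
      (((u : ℕ) < (v : ℕ) - m ∧ I2 = true) ∨
       ((v : ℕ) - m < (u : ℕ) ∧ I3 = true) ∨
       ((u : ℕ) = (v : ℕ) - m ∧ Even (u : ℕ)))))

/-- The ordered graph `M^>_I(X,Y)`: as `M^<_I(X,Y)` but with the `y`-indices reversed,
i.e. vertex `m + p` plays the role of `y_{m-p}` (so that `y_1 > y_2 > … > y_m`). -/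
def Mgt (m : ℕ) (I1 I2 I3 I4 : Bool) : SimpleGraph (Fin (2 * m)) :=
  SimpleGraph.fromRel (fun u v =>
    ((u : ℕ) < m ∧ (v : ℕ) < m ∧ I1 = true) ∨
    (m ≤ (u : ℕ) ∧ m ≤ (v : ℕ) ∧ I4 = true) ∨
    ((u : ℕ) < m ∧ m ≤ (v : ℕ) ∧
      (((u : ℕ) < 2 * m - 1 - (v : ℕ) ∧ I2 = true) ∨
       (2 * m - 1 - (v : ℕ) < (u : ℕ) ∧ I3 = true) ∨
       ((u : ℕ) = 2 * m - 1 - (v : ℕ) ∧ Even (u : ℕ)))))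

/-- `B` is a set of consecutive vertices which is pairwise 1-homogeneous. -/
def IsHomInterval {N : ℕ} (G : SimpleGraph (Fin N)) (B : Set (Fin N)) : Prop :=
  (∀ x y z : Fin N, x ∈ B → z ∈ B → x ≤ y → y ≤ z → y ∈ B) ∧
  (∀ x ∈ B, ∀ y ∈ B, lHom G 1 x y)

/-- A homogeneous block of `G`: a maximal 1-homogeneous set of consecutive vertices. -/
def IsHomBlock {N : ℕ} (G : SimpleGraph (Fin N)) (B : Set (Fin N)) : Prop :=
  B.Nonempty ∧ IsHomInterval G B ∧ ∀ B' : Set (Fin N), B ⊆ B' → IsHomInterval G B' → B = B'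

/-- `G` has at most `k` homogeneous blocks. -/
def HomBlocksLE {N : ℕ} (G : SimpleGraph (Fin N)) (k : ℕ) : Prop :=
  {B : Set (Fin N) | IsHomBlock G B}.ncard ≤ k

/-- `TailBound G k M` : the homogeneous block sequence `t_1 ≥ t_2 ≥ …` of `G` satisfies
`Σ_{i=k+2}^∞ t_i ≤ M`, i.e. some (equivalently, the largest) `k+1` homogeneous blocks
cover all but at most `M` vertices. -/
def TailBound {N : ℕ} (G : SimpleGraph (Fin N)) (k M : ℕ) : Prop :=
  ∃ S : Finset (Set (Fin N)), S.card ≤ k + 1 ∧ (∀ B ∈ S, IsHomBlock G B) ∧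
    {v : Fin N | ∀ B ∈ S, v ∉ B}.ncard ≤ M

/-- An ordered graph is irreducible if no pair of vertices `u < v` separates its edges. -/
def IrredGraph {N : ℕ} (G : SimpleGraph (Fin N)) : Prop :=
  ¬ ∃ u v : Fin N, u < v ∧
      ∀ i j : Fin N, i < j → G.Adj i j → ((j : ℕ) ≤ (u : ℕ) ∨ (v : ℕ) ≤ (i : ℕ))

/-- `G` is `ℓ`-empty: it has no edges of length at least `ℓ`. -/
def lEmpty {N : ℕ} (G : SimpleGraph (Fin N)) (ℓ : ℕ) : Prop :=
  ∀ u v : Fin N, G.Adj u v → ((u : ℤ) - (v : ℤ)).natAbs < ℓ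

/-- `IsFamSum G sz Gs` : `G = G_1 + … + G_s`, the consecutive sum of the ordered graphs
`Gs 0, …, Gs (s-1)` (of orders `sz 0, …, sz (s-1)`), with no edges between summands. -/
def IsFamSum {N s : ℕ} (G : SimpleGraph (Fin N)) (sz : Fin s → ℕ)
    (Gs : ∀ i, SimpleGraph (Fin (sz i))) : Prop :=
  N = ∑ i, sz i ∧
  ∀ u v : Fin N, G.Adj u v ↔ ∃ (i : Fin s) (x y : Fin (sz i)),
    (Gs i).Adj x y ∧
    (u : ℕ) = (∑ j ∈ Finset.univ.filter (fun j => j < i), sz j) + (x : ℕ) ∧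
    (v : ℕ) = (∑ j ∈ Finset.univ.filter (fun j => j < i), sz j) + (y : ℕ)

/-- `(Gs 0, …, Gs (s-1))` is the irreducible block decomposition of `G`:
`G = G_1 + ⋯ + G_s` with every block nonempty and irreducible.  (Such a
decomposition is unique.) -/
def IsIrredDecomp {N s : ℕ} (G : SimpleGraph (Fin N)) (sz : Fin s → ℕ)
    (Gs : ∀ i, SimpleGraph (Fin (sz i))) : Prop :=
  IsFamSum G sz Gs ∧ (∀ i, 1 ≤ sz i) ∧ ∀ i, IrredGraph (Gs i)

/-- `J_1^{(n)} = K_n`. -/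
def Jgraph1 (n : ℕ) : SimpleGraph (Fin n) := ⊤

/-- `J_2^{(n)}` : single edge `{1,n}`. -/
def Jgraph2 (n : ℕ) : SimpleGraph (Fin n) :=
  SimpleGraph.fromRel (fun u v => (u : ℕ) = 0 ∧ (v : ℕ) = n - 1)

/-- `J_3^{(n)}` : star at the first vertex. -/
def Jgraph3 (n : ℕ) : SimpleGraph (Fin n) :=
  SimpleGraph.fromRel (fun u _ => (u : ℕ) = 0)

/-- `J_4^{(n)}` : star at the last vertex. -/
def Jgraph4 (n : ℕ) : SimpleGraph (Fin n) :=
  SimpleGraph.fromRel (fun _ v => (v : ℕ) = n - 1)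

/-- `L^{(n)}` : the monotone path. -/
def Lgraph (n : ℕ) : SimpleGraph (Fin n) :=
  SimpleGraph.fromRel (fun u v => (v : ℕ) = (u : ℕ) + 1)

/-- `Q_1` : edge set `{13, 24}` on `[4]`. -/
def Qgraph1 : SimpleGraph (Fin 4) :=
  SimpleGraph.fromRel (fun u v => ((u : ℕ) = 0 ∧ (v : ℕ) = 2) ∨ ((u : ℕ) = 1 ∧ (v : ℕ) = 3))

/-- `Q_2` : edge set `{14, 23}` on `[4]`. -/
def Qgraph2 : SimpleGraph (Fin 4) :=
  SimpleGraph.fromRel (fun u v => ((u : ℕ) = 0 ∧ (v : ℕ) = 3) ∨ ((u : ℕ) = 1 ∧ (v : ℕ) = 2))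

/-- `G` is order-isomorphic to a member of the family `𝒥`. -/
def InJ {n : ℕ} (G : SimpleGraph (Fin n)) : Prop :=
  G = Jgraph1 n ∨ G = Jgraph2 n ∨ G = Jgraph3 n ∨ G = Jgraph4 n ∨ G = Lgraph n ∨
  (n = 4 ∧ IndSub G Qgraph1) ∨ (n = 4 ∧ IndSub G Qgraph2)

/-- `G` is order-isomorphic to a member of `𝒥_ℓ`. -/
def InJle (ℓ : ℕ) {n : ℕ} (G : SimpleGraph (Fin n)) : Prop :=
  (n ≤ ℓ ∧ (G = Jgraph1 n ∨ G = Jgraph2 n ∨ G = Jgraph3 n ∨ G = Jgraph4 n ∨ G = Lgraph n)) ∨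
  (4 ≤ ℓ ∧ n = 4 ∧ (IndSub G Qgraph1 ∨ IndSub G Qgraph2))

/-- `A` is a sum `B_1 + ⋯ + B_t` of members of `𝒥_ℓ` which are pairwise comparable in
the induced ordered subgraph order. -/
def InJA (ℓ : ℕ) {n : ℕ} (A : SimpleGraph (Fin n)) : Prop :=
  ∃ (t : ℕ) (sz : Fin t → ℕ) (Bs : ∀ j, SimpleGraph (Fin (sz j))),
    IsFamSum A sz Bs ∧ (∀ j, InJle ℓ (Bs j)) ∧
    ∀ j j', IndSub (Bs j) (Bs j') ∨ IndSub (Bs j') (Bs j)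

/-- `G ∈ 𝒥(k,ℓ)`. -/
def InJkl (k ℓ : ℕ) {n : ℕ} (G : SimpleGraph (Fin n)) : Prop :=
  ∃ (s : ℕ) (sz : Fin s → ℕ) (As : ∀ i, SimpleGraph (Fin (sz i))),
    s ≤ k ∧ IsFamSum G sz As ∧ ∀ i, InJA ℓ (As i)


/-- A configuration extracted from a graph in `P` with `k+1` large homogeneous blocks. -/
structure Conf (P : HerProp) (k M : ℕ) where
  N : ℕ
  G : SimpleGraph ℕ
  s : ℕ → ℕ
  e : ℕ → ℕ
  sub : ∀ (n : ℕ) (f : Fin n ↪o ℕ), (∀ i, f i < N) → G.comap f ∈ P.mem n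
  len : ∀ i ≤ k, s i + M ≤ e i
  top : ∀ i ≤ k, e i ≤ N
  ord : ∀ i j, i < j → j ≤ k → e i ≤ s j
  twin : ∀ i ≤ k, ∀ x y, s i ≤ x → x < e i → s i ≤ y → y < e i →
    ∀ v, v ≠ x → v ≠ y → (G.Adj x v ↔ G.Adj y v)
  sep : ∀ i < k, ∃ x w, s i ≤ x ∧ x < e i ∧ w < N ∧ w ≠ x ∧ w ≠ e i ∧
    (G.Adj x w ↔ ¬ G.Adj (e i) w)

lemma lHom_one {N : ℕ} (G : SimpleGraph (Fin N)) (x y : Fin N) :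
    lHom G 1 x y ↔ ∀ v, v ≠ x → v ≠ y → (G.Adj x v ↔ G.Adj y v) := by
  unfold lHom
  refine forall_congr' fun v => ?_
  have h (a b : Fin N) : 1 ≤ ((a : ℤ) - (b : ℤ)).natAbs ↔ a ≠ b := by
    rw [Ne, Fin.ext_iff]; omega
  rw [h, h]

lemma lHom_symm {N : ℕ} {G : SimpleGraph (Fin N)} {x y : Fin N} (h : lHom G 1 x y) :
    lHom G 1 y x := by
  rw [lHom_one] at *
  intro v h1 h2
  exact (h v h2 h1).symm

lemma lHom_trans {N : ℕ} {G : SimpleGraph (Fin N)} {x y z : Fin N} (h : lHom G 1 x y)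
    (h' : lHom G 1 y z) : lHom G 1 x z := by
  rw [lHom_one] at *
  intro v h1 h2
  by_cases hv : v = y
  · subst hv
    by_cases hxz : x = z
    · subst hxz; rfl
    have e1 := h z (Ne.symm hxz) h2.symm
    have e2 := h' x h1.symm hxz
    rw [G.adj_comm x v, G.adj_comm z v, e2, ← e1, G.adj_comm]
  · rw [h v h1 hv, h' v hv h2]

lemma homBlock_Icc {N : ℕ} {G : SimpleGraph (Fin N)} {B : Set (Fin N)} (h : IsHomBlock G B) :
    ∃ a b : Fin N, a ≤ b ∧ B = Set.Icc a b := by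
  obtain ⟨hn, ⟨hc, _⟩, _⟩ := h
  obtain ⟨a, ha, ha'⟩ := Set.exists_min_image B id (Set.toFinite B) hn
  obtain ⟨b, hb, hb'⟩ := Set.exists_max_image B id (Set.toFinite B) hn
  refine ⟨a, b, ha' b hb, ?_⟩
  ext v
  exact ⟨fun hv => ⟨ha' v hv, hb' v hv⟩, fun hv => hc a v b ha hb hv.1 hv.2⟩

lemma homBlock_eq {N : ℕ} {G : SimpleGraph (Fin N)} {B B' : Set (Fin N)} (h : IsHomBlock G B)
    (h' : IsHomBlock G B') (x : Fin N) (hx : x ∈ B) (hx' : x ∈ B') : B = B' := by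
  have key : IsHomInterval G (B ∪ B') := by
    obtain ⟨a, b, hab, hB⟩ := homBlock_Icc h
    obtain ⟨a', b', hab', hB'⟩ := homBlock_Icc h'
    constructor
    · subst hB hB'
      intro u v w hu hw huv hvw
      simp only [Set.mem_union, Set.mem_Icc, Fin.le_def] at *
      omega
    · have hh : ∀ u ∈ B ∪ B', lHom G 1 u x := by
        rintro u (hu | hu)
        · exact h.2.1.2 u hu x hx
        · exact h'.2.1.2 u hu x hx'
      intro u hu v hv
      exact lHom_trans (hh u hu) (lHom_symm (hh v hv))
  rw [h.2.2 _ Set.subset_union_left key, ← h'.2.2 _ Set.subset_union_right key]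

lemma exists_conf (P : HerProp) (k M : ℕ)
    (h : ∀ M : ℕ, ∃ (N : ℕ) (G : SimpleGraph (Fin N)), G ∈ P.mem N ∧
        ∃ S : Finset (Set (Fin N)), S.card = k + 1 ∧
          ∀ B ∈ S, IsHomBlock G B ∧ M ≤ B.ncard) : Nonempty (Conf P k M) := by
  classical
  obtain ⟨N, G, hG, S, hS, hB⟩ := h M
  have hI : ∀ B : S, ∃ a b : Fin N, a ≤ b ∧ (B : Set (Fin N)) = Set.Icc a b := fun B =>
    homBlock_Icc (hB B B.2).1
  choose a b hab hIcc using hI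
  have ainj : Function.Injective a := by
    intro B B' hBB
    apply Subtype.ext
    refine homBlock_eq (hB B B.2).1 (hB B' B'.2).1 (a B) ?_ ?_
    · rw [hIcc]; exact ⟨le_refl _, hab _⟩
    · rw [hIcc, hBB]; exact ⟨le_refl _, hab _⟩
  have hT : (Finset.univ.image a).card = k + 1 := by
    rw [Finset.card_image_of_injective _ ainj]; simpa using hS
  let σ := (Finset.univ.image a).orderEmbOfFin hT
  have hσ : ∀ i, ∃ B : S, a B = σ i := by
    intro i
    have := Finset.orderEmbOfFin_mem (Finset.univ.image a) hT i
    rw [Finset.mem_image] at this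
    obtain ⟨B, _, hB'⟩ := this
    exact ⟨B, hB'⟩
  choose β hβ using hσ
  have hblk : ∀ i, IsHomBlock G (Set.Icc (σ i) (b (β i))) := by
    intro i
    have := (hB _ (β i).2).1
    rwa [hIcc, hβ] at this
  have hsz : ∀ i, (σ i : ℕ) + M ≤ b (β i) + 1 := by
    intro i
    have := (hB _ (β i).2).2
    rw [hIcc, hβ, Set.ncard_eq_toFinset_card', Set.toFinset_Icc, Fin.card_Icc] at this
    have h2 : (σ i : ℕ) ≤ b (β i) := by rw [← hβ]; exact hab _
    omega
  have hord : ∀ i j, i < j → b (β i) < σ j := by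
    intro i j hij
    by_contra hcon
    push Not at hcon
    have h1 : σ i < σ j := σ.strictMono hij
    have h2 := homBlock_eq (hblk i) (hblk j) (σ j) ⟨h1.le, hcon⟩
      ⟨le_refl _, by rw [← hβ]; exact hab _⟩
    have h3 : σ i ∈ Set.Icc (σ j) (b (β j)) := by
      rw [← h2]; exact ⟨le_refl _, by rw [← hβ]; exact hab _⟩
    exact absurd h3.1 (not_le.mpr h1)
  have hadj : ∀ x y : Fin N, (G.map Fin.valEmbedding).Adj x y ↔ G.Adj x y := by
    intro x y
    exact SimpleGraph.map_adj_apply (f := Fin.valEmbedding)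
  have hnadj : ∀ x v : ℕ, N ≤ v → ¬ (G.map Fin.valEmbedding).Adj x v := by
    intro x v hv hadj
    rw [SimpleGraph.map_adj] at hadj
    obtain ⟨u, w, _, _, hw⟩ := hadj
    have := w.2
    simp at hw
    omega
  refine ⟨⟨N, G.map Fin.valEmbedding, fun i => σ (Fin.ofNat (k+1) i),
    fun i => b (β (Fin.ofNat (k+1) i)) + 1, ?_, ?_, ?_, ?_, ?_, ?_⟩⟩
  · intro n f hf
    refine P.hered _ G ⟨OrderEmbedding.ofStrictMono (fun i => ⟨f i, hf i⟩) ?_, ?_⟩ hG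
    · intro i j hij
      exact f.strictMono hij
    · intro i j
      rw [SimpleGraph.comap_adj]
      exact hadj ⟨f i, hf i⟩ ⟨f j, hf j⟩
  · intro i hi
    exact hsz _
  · intro i hi
    exact (b (β (Fin.ofNat (k+1) i))).2
  · intro i j hij hj
    have := hord (Fin.ofNat (k+1) i) (Fin.ofNat (k+1) j) (by
      rw [Fin.lt_def, Fin.val_ofNat, Fin.val_ofNat, Nat.mod_eq_of_lt (by omega),
        Nat.mod_eq_of_lt (by omega)]
      exact hij)
    exact this
  · intro i hi x y hx hx' hy hy' v hvx hvy
    have hb := (b (β (Fin.ofNat (k+1) i))).2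
    have := (hblk (Fin.ofNat (k+1) i)).2.1.2 ⟨x, by omega⟩
      ⟨hx, by rw [Fin.le_def]; simp only; omega⟩ ⟨y, by omega⟩
      ⟨hy, by rw [Fin.le_def]; simp only; omega⟩
    rw [lHom_one] at this
    by_cases hv : v < N
    · have h2 := this ⟨v, hv⟩ (by simpa [Fin.ext_iff] using hvx) (by simpa [Fin.ext_iff] using hvy)
      rw [← hadj, ← hadj] at h2
      exact h2
    · have h1 := hnadj x v (by omega)
      have h2 := hnadj y v (by omega)
      tauto
  · intro i hi
    have hlt := hord (Fin.ofNat (k+1) i) (Fin.ofNat (k+1) (i+1)) (by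
      rw [Fin.lt_def, Fin.val_ofNat, Fin.val_ofNat, Nat.mod_eq_of_lt (by omega),
        Nat.mod_eq_of_lt (by omega)]
      omega)
    have hlt2 := (σ (Fin.ofNat (k+1) (i+1))).2
    have hbl := hblk (Fin.ofNat (k+1) i)
    generalize σ (Fin.ofNat (k+1) (i+1)) = z' at *
    have hle : σ (Fin.ofNat (k+1) i) ≤ b (β (Fin.ofNat (k+1) i)) := by rw [← hβ]; exact hab _
    generalize σ (Fin.ofNat (k+1) i) = p at *
    generalize b (β (Fin.ofNat (k+1) i)) = q at *
    rw [Fin.lt_def] at hlt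
    let z : Fin N := ⟨q + 1, by omega⟩
    have hnot : ∃ x ∈ Set.Icc p q, ¬ lHom G 1 x z := by
      by_contra hcon
      push Not at hcon
      have key : IsHomInterval G (Set.Icc p z) := by
        constructor
        · intro u v w hu hw huv hvw
          exact ⟨hu.1.trans huv, hvw.trans hw.2⟩
        · have hh : ∀ u ∈ Set.Icc p z, lHom G 1 u z := by
            intro u hu
            by_cases huz : u = z
            · subst huz; rw [lHom_one]; intros; rfl
            · refine hcon u ⟨hu.1, ?_⟩
              have := hu.2
              rw [Fin.le_def] at this ⊢
              rw [Fin.ext_iff] at huz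
              simp only [z] at this huz
              omega
          intro u hu v hv
          exact lHom_trans (hh u hu) (lHom_symm (hh v hv))
      have hqz : q < z := by rw [Fin.lt_def]; simp [z]
      have h1 := hbl.2.2 _ (Set.Icc_subset_Icc_right hqz.le) key
      have h2 : z ∈ Set.Icc p q := by rw [h1]; exact ⟨hle.trans hqz.le, le_refl _⟩
      exact absurd h2.2 (not_le.mpr hqz)
    obtain ⟨x, hx, hxz⟩ := hnot
    rw [lHom_one] at hxz
    push Not at hxz
    obtain ⟨w, hwx, hwz, hw⟩ := hxz
    refine ⟨x, w, hx.1, ?_, w.2, ?_, ?_, ?_⟩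
    · have := hx.2
      rw [Fin.le_def] at this; omega
    · simpa [Fin.ext_iff] using hwx
    · simpa [Fin.ext_iff, z] using hwz
    · rw [hadj]
      have := hadj z w
      simp only [z] at this
      rw [this]
      tauto

lemma Conf.family {P : HerProp} {k M : ℕ} (C : Conf P k M) (n : ℕ) (f : ℕ → ℕ → ℕ)
    (hf : ∀ t < n, ∀ i j, i < j → j < n → f t i < f t j)
    (hN : ∀ t < n, ∀ i < n, f t i < C.N)
    (hd : ∀ t t', t < t' → t' < n → ∃ i j, i < n ∧ j < n ∧
      ¬ (C.G.Adj (f t i) (f t j) ↔ C.G.Adj (f t' i) (f t' j))) : n ≤ speed P n := by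
  let g : Fin n → SimpleGraph (Fin n) := fun t => C.G.comap (fun i : Fin n => f t i)
  have hg : ∀ t t', g t = g t' → ¬ t < t' := by
    intro t t' heq hlt
    obtain ⟨i, j, hi, hj, hij⟩ := hd t t' hlt t'.2
    apply hij
    have : (g t).Adj ⟨i, hi⟩ ⟨j, hj⟩ ↔ (g t').Adj ⟨i, hi⟩ ⟨j, hj⟩ := by rw [heq]
    exact this
  have hinj : Function.Injective g := by
    intro t t' heq
    exact le_antisymm (not_lt.mp (hg _ _ heq.symm)) (not_lt.mp (hg _ _ heq))
  have hmem : Set.range g ⊆ P.mem n := by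
    rintro _ ⟨t, rfl⟩
    exact C.sub n (OrderEmbedding.ofStrictMono (fun i : Fin n => f t i)
      (fun i j hij => hf t t.2 i j hij j.2)) (fun i => hN t t.2 i i.2)
  have h1 := Set.ncard_le_ncard hmem (Set.toFinite _)
  rw [← Set.image_univ, Set.ncard_image_of_injective _ hinj, Set.ncard_univ, Nat.card_fin] at h1
  exact h1

lemma Conf.within {P : HerProp} {k M : ℕ} (C : Conf P k M) (hM : 2 ≤ M) (i : ℕ) (hi : i ≤ k)
    (x y : ℕ) (hx : C.s i ≤ x) (hx' : x < C.e i) (hy : C.s i ≤ y) (hy' : y < C.e i)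
    (hxy : x ≠ y) : C.G.Adj x y ↔ C.G.Adj (C.s i) (C.s i + 1) := by
  have hl := C.len i hi
  rw [C.G.adj_comm (C.s i)]
  by_cases hys : y = C.s i
  · rw [hys] at hxy ⊢
    exact C.twin i hi x (C.s i + 1) hx hx' (by omega) (by omega) _ hxy.symm (by omega)
  · rw [C.twin i hi x (C.s i) hx hx' (by omega) (by omega) y hxy.symm hys, C.G.adj_comm,
      C.twin i hi y (C.s i + 1) hy hy' (by omega) (by omega) _ (Ne.symm hys) (by omega)]

lemma Conf.out {P : HerProp} {k M : ℕ} (C : Conf P k M) (i : ℕ) (hi : i ≤ k)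
    (x v : ℕ) (hx : C.s i ≤ x) (hx' : x < C.e i) (hv : v < C.s i ∨ C.e i ≤ v) :
    C.G.Adj x v ↔ C.G.Adj (C.s i) v :=
  C.twin i hi x (C.s i) hx hx' le_rfl (by omega) v (by omega) (by omega)

set_option maxHeartbeats 4000000 in
lemma Conf.k_one {P : HerProp} (n : ℕ) (C : Conf P 1 (n + 2)) : n ≤ speed P n := by
  obtain ⟨x, w, hx, hx', hw, hwx, hwe, hsep⟩ := C.sep 0 (by norm_num)
  have hl0 := C.len 0 (by norm_num)
  have hl1 := C.len 1 le_rfl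
  have ht := C.top 1 le_rfl
  have hord := C.ord 0 1 (by norm_num) le_rfl
  have W0 := C.within (by omega) 0 (by norm_num)
  have W1 := C.within (by omega) 1 le_rfl
  have O0 := C.out 0 (by norm_num)
  have O1 := C.out 1 le_rfl
  have O0' : ∀ x v, C.s 0 ≤ x → x < C.e 0 → v < C.s 0 ∨ C.e 0 ≤ v →
      (C.G.Adj v x ↔ C.G.Adj v (C.s 0)) := by
    intro x v h1 h2 h3
    rw [C.G.adj_comm v, C.G.adj_comm v]; exact O0 x v h1 h2 h3
  have O1' : ∀ x v, C.s 1 ≤ x → x < C.e 1 → v < C.s 1 ∨ C.e 1 ≤ v →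
      (C.G.Adj v x ↔ C.G.Adj v (C.s 1)) := by
    intro x v h1 h2 h3
    rw [C.G.adj_comm v, C.G.adj_comm v]; exact O1 x v h1 h2 h3
  have Bt : ∀ x y, C.s 0 ≤ x → x < C.e 0 → C.s 1 ≤ y → y < C.e 1 →
      (C.G.Adj x y ↔ C.G.Adj (C.s 0) (C.s 1)) := by
    intro x y h1 h2 h3 h4
    rw [O0 x y h1 h2 (by omega), O1' y _ h3 h4 (by omega)]
  have Bt' : ∀ x y, C.s 0 ≤ x → x < C.e 0 → C.s 1 ≤ y → y < C.e 1 →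
      (C.G.Adj y x ↔ C.G.Adj (C.s 0) (C.s 1)) := by
    intro x y h1 h2 h3 h4
    rw [C.G.adj_comm]; exact Bt x y h1 h2 h3 h4
  have hcomm := C.G.adj_comm
  have FAM := C.family n
  generalize hz : C.e 0 = z at *
  generalize C.s 0 = s at *
  generalize C.s 1 = r at *
  generalize C.e 1 = e at *
  generalize C.N = N at *
  generalize C.G.Adj = A at *
  -- small `n`
  obtain hn | hn | hn : n ≤ 1 ∨ n = 2 ∨ 3 ≤ n := by omega
  · refine FAM (fun t i => s + i) ?_ ?_ ?_
    · intros; omega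
    · intros; omega
    · intros; omega
  · subst hn
    have key : ∀ y, y < N → w ≠ y → ∃ p q, p < q ∧ q < N ∧ (A p q ↔ A y w) := by
      intro y hy hwy
      rcases lt_or_gt_of_ne hwy with h | h
      · exact ⟨w, y, h, hy, hcomm _ _⟩
      · exact ⟨y, w, h, hw, Iff.rfl⟩
    obtain ⟨p, q, hpq, hq, hA⟩ := key x (by omega) hwx
    obtain ⟨p', q', hpq', hq', hA'⟩ := key z (by omega) hwe
    refine FAM (fun t i => if t = 0 then (if i = 0 then p else q)
      else (if i = 0 then p' else q')) ?_ ?_ ?_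
    · intros; try beta_reduce
      split_ifs <;> omega
    · intros; try beta_reduce
      split_ifs <;> omega
    · intro t t' htt ht'
      have h0 : t = 0 := by omega
      have h1 : t' = 1 := by omega
      refine ⟨0, 1, by omega, by omega, ?_⟩
      simp only [h0, h1, if_true, one_ne_zero, if_false]
      rw [hA, hA']
      tauto
  by_cases hab : A s (s+1) ↔ A s r
  swap
  · refine FAM (fun t i => if i < t + 1 then s + i else r + i) ?_ ?_ ?_
    · intros; try beta_reduce; split_ifs <;> omega
    · intros; try beta_reduce; split_ifs <;> omega
    · intro t t' htt ht'
      refine ⟨0, t+1, by omega, by omega, ?_⟩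
      try beta_reduce
      rw [if_pos (by omega), if_neg (by omega), if_pos (by omega), if_pos (by omega)]
      rw [Bt (s + 0) (r + (t + 1)) (by omega) (by omega) (by omega) (by omega),
        W0 (s + 0) (s + (t + 1)) (by omega) (by omega) (by omega) (by omega) (by omega)]
      tauto
  by_cases hbc : A r (r+1) ↔ A s r
  swap
  · refine FAM (fun t i => if i < t then s + i else r + i) ?_ ?_ ?_
    · intros; try beta_reduce; split_ifs <;> omega
    · intros; try beta_reduce; split_ifs <;> omega
    · intro t t' htt ht'
      refine ⟨t, n-1, by omega, by omega, ?_⟩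
      try beta_reduce
      rw [if_neg (by omega), if_neg (by omega), if_pos (by omega), if_neg (by omega)]
      rw [Bt (s + t) (r + (n - 1)) (by omega) (by omega) (by omega) (by omega),
        W1 (r + t) (r + (n - 1)) (by omega) (by omega) (by omega) (by omega) (by omega)]
      tauto
  rw [hbc] at W1
  rw [hab] at W0
  clear hbc hab
  generalize A s r = a at *
  -- a vertex separating the two blocks
  by_cases hs : ∃ u < N, (u < s ∨ z ≤ u) ∧ (u < r ∨ e ≤ u) ∧ ¬ (A u s ↔ A u r)
  · obtain ⟨u, huN, hu1, hu2, hu⟩ := hs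
    obtain h | h | h : u < s ∨ (z ≤ u ∧ u < r) ∨ e ≤ u := by omega
    · refine FAM (fun t i => if i = 0 then u else if i < t + 1 then s + i else r + i) ?_ ?_ ?_
      · intros; try beta_reduce; split_ifs <;> omega
      · intros; try beta_reduce; split_ifs <;> omega
      · intro t t' htt ht'
        refine ⟨0, t+1, by omega, by omega, ?_⟩
        try beta_reduce
        rw [if_pos rfl, if_neg (by omega), if_neg (by omega), if_pos rfl, if_neg (by omega),
          if_pos (by omega)]
        rw [O0' (s + (t + 1)) u (by omega) (by omega) (by omega), O1' (r + (t + 1)) u (by omega) (by omega) (by omega)]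
        tauto
    · refine FAM (fun t i => if i = t then u else if i < t then s + i else r + i) ?_ ?_ ?_
      · intros; try beta_reduce; split_ifs <;> omega
      · intros; try beta_reduce; split_ifs <;> omega
      · intro t t' htt ht'
        refine ⟨t, t', by omega, by omega, ?_⟩
        try beta_reduce
        rw [if_pos rfl, if_neg (by omega), if_neg (by omega), if_neg (by omega), if_pos (by omega),
          if_pos rfl]
        rw [O0 (s + t) u (by omega) (by omega) (by omega), O1' (r + t') u (by omega) (by omega) (by omega),
          hcomm s u]
        tauto
    · refine FAM (fun t i => if i = n - 1 then u else if i < t then s + i else r + i) ?_ ?_ ?_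
      · intros; try beta_reduce; split_ifs <;> omega
      · intros; try beta_reduce; split_ifs <;> omega
      · intro t t' htt ht'
        refine ⟨t, n-1, by omega, by omega, ?_⟩
        try beta_reduce
        rw [if_neg (by omega), if_neg (by omega), if_pos rfl, if_neg (by omega), if_pos (by omega),
          if_pos rfl]
        rw [O0 (s + t) u (by omega) (by omega) (by omega), O1 (r + t) u (by omega) (by omega) (by omega),
          hcomm s u, hcomm r u]
        tauto
  push Not at hs
  have U0 : ∀ u < N, (u < s ∨ z ≤ u) → (u < r ∨ e ≤ u) → ∀ v, s ≤ v → v < z →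
      (A v u ↔ A u s) := fun u h1 h2 h3 v h4 h5 => by rw [O0 v u h4 h5 h2, hcomm]
  have U1 : ∀ u < N, (u < s ∨ z ≤ u) → (u < r ∨ e ≤ u) → ∀ v, r ≤ v → v < e →
      (A v u ↔ A u s) := fun u h1 h2 h3 v h4 h5 => by rw [O1 v u h4 h5 h3, hcomm, hs u h1 h2 h3]
  have V0 : ∀ u < N, (u < s ∨ z ≤ u) → (u < r ∨ e ≤ u) → ∀ v, s ≤ v → v < z →
      (A u v ↔ A u s) := fun u h1 h2 h3 v h4 h5 => by rw [hcomm, U0 u h1 h2 h3 v h4 h5]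
  have V1 : ∀ u < N, (u < s ∨ z ≤ u) → (u < r ∨ e ≤ u) → ∀ v, r ≤ v → v < e →
      (A u v ↔ A u s) := fun u h1 h2 h3 v h4 h5 => by rw [hcomm, U1 u h1 h2 h3 v h4 h5]
  -- a vertex between the blocks joined in the wrong way
  by_cases hs2 : ∃ u, z ≤ u ∧ u < r ∧ ¬ (A u s ↔ a)
  · obtain ⟨u, hu1, hu2, hu⟩ := hs2
    have U0 := U0 u (by omega) (by omega) (by omega)
    have U1 := U1 u (by omega) (by omega) (by omega)
    have V0 := V0 u (by omega) (by omega) (by omega)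
    have V1 := V1 u (by omega) (by omega) (by omega)
    refine FAM (fun t i => if i = t then u else if i < t then s + i else r + i) ?_ ?_ ?_
    · intros; try beta_reduce; split_ifs <;> omega
    · intros; try beta_reduce; split_ifs <;> omega
    · intro t t' htt ht'
      obtain ⟨q, hq, hqt, hqt'⟩ : ∃ q, q < n ∧ q ≠ t ∧ q ≠ t' := by
        by_cases h0 : t = 0
        · by_cases h1 : t' = 1
          · exact ⟨2, by omega, by omega, by omega⟩
          · exact ⟨1, by omega, by omega, by omega⟩
        · exact ⟨0, by omega, by omega, by omega⟩
      refine ⟨t, q, by omega, by omega, ?_⟩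
      try beta_reduce
      rw [if_pos rfl, if_neg hqt, if_neg htt.ne, if_pos htt, if_neg hqt']
      have h1 : A u (if q < t then s + q else r + q) ↔ A u s := by
        split_ifs
        · exact V0 _ (by omega) (by omega)
        · exact V1 _ (by omega) (by omega)
      have h2 : A (s + t) (if q < t' then s + q else r + q) ↔ a := by
        split_ifs
        · exact W0 _ _ (by omega) (by omega) (by omega) (by omega) (by omega)
        · exact Bt _ _ (by omega) (by omega) (by omega) (by omega)
      rw [h1, h2]
      exact hu
  push Not at hs2
  have hzr : z < r := by
    by_contra hcon
    have hzr : z = r := by omega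
    apply (iff_not_self (a := A z w))
    have e1 : (w < s ∨ z ≤ w) ∧ (w < r ∨ e ≤ w) ∨ (s ≤ w ∧ w < z) ∨ (r ≤ w ∧ w < e) := by omega
    rcases e1 with ⟨e1, e2⟩ | ⟨e1, e2⟩ | ⟨e1, e2⟩
    · rwa [U0 w hw e1 e2 x hx hx', ← U1 w hw e1 e2 z (by omega) (by omega)] at hsep
    · rwa [W0 x w hx hx' e1 e2 hwx.symm, ← Bt' w z e1 e2 (by omega) (by omega)] at hsep
    · rwa [Bt x w hx hx' e1 e2, ← W1 z w (by omega) (by omega) e1 e2 hwe.symm] at hsep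
  have hza := hs2 z le_rfl hzr
  have U0z := U0 z (by omega) (by omega) (by omega)
  have U1z := U1 z (by omega) (by omega) (by omega)
  have V0z := V0 z (by omega) (by omega) (by omega)
  have V1z := V1 z (by omega) (by omega) (by omega)
  have hwB : (w < s ∨ z ≤ w) ∧ (w < r ∨ e ≤ w) := by
    by_contra hcon
    apply (iff_not_self (a := A z w))
    have e1 : (s ≤ w ∧ w < z) ∨ (r ≤ w ∧ w < e) := by omega
    rcases e1 with ⟨e1, e2⟩ | ⟨e1, e2⟩
    · rwa [W0 x w hx hx' e1 e2 hwx.symm, ← hza, ← V0z w e1 e2] at hsep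
    · rwa [Bt x w hx hx' e1 e2, ← hza, ← V1z w e1 e2] at hsep
  have U0w := U0 w hw hwB.1 hwB.2
  have U1w := U1 w hw hwB.1 hwB.2
  have V0w := V0 w hw hwB.1 hwB.2
  have V1w := V1 w hw hwB.1 hwB.2
  rw [U0w x hx hx'] at hsep
  obtain h | h | h : w < s ∨ (z < w ∧ w < r) ∨ e ≤ w := by omega
  · refine FAM (fun t i => if t = n - 1 then s + i else if i = 0 then w else
      if i = t + 1 then z else if i < t + 1 then s + i else r + i) ?_ ?_ ?_
    · intros; try beta_reduce; split_ifs <;> omega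
    · intros; try beta_reduce; split_ifs <;> omega
    · intro t t' htt ht'
      by_cases ht2 : t' = n - 1
      · by_cases hwa : A w s ↔ a
        · refine ⟨0, t+1, by omega, by omega, ?_⟩
          try beta_reduce
          rw [if_neg (by omega), if_pos rfl, if_neg (by omega), if_neg (by omega), if_pos rfl,
            if_pos ht2, if_pos ht2]
          rw [W0 (s + 0) (s + (t + 1)) (by omega) (by omega) (by omega) (by omega) (by omega), hcomm w z]
          tauto
        · obtain ⟨q, hq0, hq, hqt⟩ : ∃ q, 0 < q ∧ q < n ∧ q ≠ t + 1 := by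
            by_cases h0 : t = 0
            · exact ⟨2, by omega, by omega, by omega⟩
            · exact ⟨1, by omega, by omega, by omega⟩
          refine ⟨0, q, by omega, by omega, ?_⟩
          try beta_reduce
          rw [if_neg (by omega), if_pos rfl, if_neg (by omega), if_neg (by omega), if_neg hqt,
            if_pos ht2, if_pos ht2]
          rw [W0 (s + 0) (s + q) (by omega) (by omega) (by omega) (by omega) (by omega)]
          have h1 : A w (if q < t + 1 then s + q else r + q) ↔ A w s := by
            split_ifs
            · exact V0w _ (by omega) (by omega)
            · exact V1w _ (by omega) (by omega)
          rw [h1]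
          exact hwa
      · refine ⟨0, t+1, by omega, by omega, ?_⟩
        try beta_reduce
        rw [if_neg (by omega), if_pos rfl, if_neg (by omega), if_neg (by omega), if_pos rfl,
          if_neg (by omega), if_pos rfl, if_neg (by omega), if_neg (by omega), if_neg (by omega),
          if_pos (by omega)]
        rw [V0w (s + (t + 1)) (by omega) (by omega), hcomm w z]
        tauto
  · have hwa := hs2 w h.1.le h.2
    refine FAM (fun t i => if t = n - 1 then s + i else if i = t then z else
      if i = t + 1 then w else if i < t then s + i else r + i) ?_ ?_ ?_
    · intros; try beta_reduce; split_ifs <;> omega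
    · intros; try beta_reduce; split_ifs <;> omega
    · intro t t' htt ht'
      refine ⟨t, t+1, by omega, by omega, ?_⟩
      try beta_reduce
      rw [if_neg (by omega), if_pos rfl, if_neg (by omega), if_neg (by omega), if_pos rfl]
      by_cases ht2 : t' = n - 1
      · rw [if_pos ht2, if_pos ht2, W0 (s + t) (s + (t + 1)) (by omega) (by omega) (by omega) (by omega) (by omega)]
        tauto
      · rw [if_neg ht2, if_neg ht2, if_neg (by omega), if_neg (by omega), if_pos (by omega)]
        by_cases ht3 : t + 1 = t'
        · rw [if_pos ht3, U0z (s + t) (by omega) (by omega)]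
          tauto
        · rw [if_neg ht3, if_neg (by omega), if_pos (by omega),
            W0 (s + t) (s + (t + 1)) (by omega) (by omega) (by omega) (by omega) (by omega)]
          tauto
  · refine FAM (fun t i => if t = n - 1 then s + i else if i = n - 1 then w else
      if i = t then z else if i < t then s + i else r + i) ?_ ?_ ?_
    · intros; try beta_reduce; split_ifs <;> omega
    · intros; try beta_reduce; split_ifs <;> omega
    · intro t t' htt ht'
      by_cases ht2 : t' = n - 1
      · by_cases hwa : A w s ↔ a
        · refine ⟨t, n - 1, by omega, by omega, ?_⟩
          try beta_reduce
          rw [if_neg (by omega), if_neg (by omega), if_pos rfl, if_neg (by omega), if_pos rfl,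
            if_pos ht2, if_pos ht2]
          rw [W0 (s + t) (s + (n - 1)) (by omega) (by omega) (by omega) (by omega) (by omega)]
          tauto
        · obtain ⟨q, hq, hqt⟩ : ∃ q, q < n - 1 ∧ q ≠ t := by
            by_cases h0 : t = 0
            · exact ⟨1, by omega, by omega⟩
            · exact ⟨0, by omega, by omega⟩
          refine ⟨q, n - 1, by omega, by omega, ?_⟩
          try beta_reduce
          rw [if_neg (by omega), if_neg (by omega), if_neg hqt, if_neg (show ¬ t = n - 1 by omega),
            if_pos rfl,
            if_pos ht2, if_pos ht2]
          rw [W0 (s + q) (s + (n - 1)) (by omega) (by omega) (by omega) (by omega) (by omega)]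
          have h1 : A (if q < t then s + q else r + q) w ↔ A w s := by
            split_ifs
            · exact U0w _ (by omega) (by omega)
            · exact U1w _ (by omega) (by omega)
          rw [h1]
          exact hwa
      · refine ⟨t, n - 1, by omega, by omega, ?_⟩
        try beta_reduce
        rw [if_neg (by omega), if_neg (by omega), if_pos rfl, if_neg (by omega), if_pos rfl,
          if_neg (by omega), if_neg (by omega), if_neg (by omega), if_pos (by omega),
          if_neg (by omega), if_pos rfl]
        rw [U0w (s + t) (by omega) (by omega)]
        tauto

lemma pos_card (S : Finset ℕ) {n : ℕ} (h : S.card = n) (p : Fin n) :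
    (S.filter (· < S.orderEmbOfFin h p)).card = p := by
  have : S.filter (· < S.orderEmbOfFin h p) =
      (Finset.Iio p).map (S.orderEmbOfFin h).toEmbedding := by
    ext v
    simp only [Finset.mem_filter, Finset.mem_map, Finset.mem_Iio]
    constructor
    · rintro ⟨hv, hlt⟩
      have : v ∈ Set.range (S.orderEmbOfFin h) := by
        rw [Finset.range_orderEmbOfFin]; exact hv
      obtain ⟨q, rfl⟩ := this
      exact ⟨q, (S.orderEmbOfFin h).lt_iff_lt.mp hlt, rfl⟩
    · rintro ⟨q, hq, rfl⟩
      exact ⟨Finset.orderEmbOfFin_mem _ _ _, (S.orderEmbOfFin h).lt_iff_lt.mpr hq⟩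
  rw [this, Finset.card_map, Fin.card_Iio]

lemma exists_pos (S : Finset ℕ) {n : ℕ} (h : S.card = n) (v : ℕ) (hv : v ∈ S) :
    ∃ p : Fin n, S.orderEmbOfFin h p = v := by
  have : v ∈ Set.range (S.orderEmbOfFin h) := by
    rw [Finset.range_orderEmbOfFin]; exact hv
  exact this

lemma Conf.disj {P : HerProp} {k M : ℕ} (C : Conf P k M) (i j v : ℕ) (hi : i ≤ k)
    (hj : j ≤ k) (hij : j ≠ i) (h1 : C.s j ≤ v) (h2 : v < C.e j) :
    v < C.s i ∨ C.e i ≤ v := by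
  rcases lt_or_gt_of_ne hij with h | h
  · have := C.ord j i h hi; omega
  · have := C.ord i j h hj; omega

lemma Conf.sep' {P : HerProp} {k M : ℕ} (C : Conf P k M) (hM : 2 ≤ M) (i : ℕ) (hi : i < k) :
    ∃ w, w < C.N ∧ ((∀ j ≤ k, w < C.s j ∨ C.e j ≤ w) ∨ ∃ j ≤ k, w = C.s j ∨ w = C.s j + 1) ∧
      w ≠ C.e i ∧ ∀ x, C.s i ≤ x → x < C.e i → x ≠ w → (C.G.Adj x w ↔ ¬ C.G.Adj (C.e i) w) := by
  obtain ⟨x0, w0, hx0, hx0', hw0, hwx, hwe, hsep⟩ := C.sep i hi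
  by_cases hB : ∀ j ≤ k, w0 < C.s j ∨ C.e j ≤ w0
  · refine ⟨w0, hw0, Or.inl hB, hwe, ?_⟩
    intro x hx hx' hxw
    rw [C.twin i hi.le x x0 hx hx' hx0 hx0' w0 hxw.symm hwx, hsep]
  · push Not at hB
    obtain ⟨j, hj, h1, h2⟩ := hB
    have hl := C.len j hj
    have ht := C.top j hj
    obtain ⟨w, hw, hwe'⟩ : ∃ w, (w = C.s j ∨ w = C.s j + 1) ∧ w ≠ C.e i := by
      by_cases h : C.e i = C.s j
      · exact ⟨C.s j + 1, Or.inr rfl, by omega⟩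
      · exact ⟨C.s j, Or.inl rfl, by omega⟩
    have hwl : C.s j ≤ w ∧ w < C.e j := by omega
    refine ⟨w, by omega, Or.inr ⟨j, hj, hw⟩, hwe', ?_⟩
    intro x hx hx' hxw
    have e1 : C.G.Adj (C.e i) w ↔ C.G.Adj (C.e i) w0 := by
      rw [C.G.adj_comm, C.G.adj_comm _ w0]
      exact C.twin j hj w w0 hwl.1 hwl.2 h1 h2 _ hwe'.symm hwe.symm
    have e2 : C.G.Adj x w ↔ C.G.Adj x0 w0 := by
      by_cases hji : j = i
      · subst hji
        rw [C.within hM j hj x w hx hx' hwl.1 hwl.2 hxw,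
          C.within hM j hj x0 w0 hx0 hx0' h1 h2 hwx.symm]
      · have d1 := C.disj i j w hi.le hj hji hwl.1 hwl.2
        have d2 := C.disj j i x0 hj hi.le (Ne.symm hji) hx0 hx0'
        rw [C.twin i hi.le x x0 hx hx' hx0 hx0' w (by omega) (by omega), C.G.adj_comm,
          C.G.adj_comm x0]
        exact C.twin j hj w w0 hwl.1 hwl.2 h1 h2 _ (by omega) (by omega)
    rw [e1, e2, hsep]

set_option maxHeartbeats 2000000 in
lemma Conf.main {P : HerProp} {k : ℕ} (n : ℕ) (C : Conf P k (n + 2)) (hk : 1 ≤ k) :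
    (n - (3 * k + 2)).choose k ≤ speed P n := by
  classical
  by_cases hn : n < 4 * k + 2
  · rw [Nat.choose_eq_zero_of_lt (by omega)]; exact Nat.zero_le _
  have hsep : ∀ i : ℕ, ∃ w, i < k → w < C.N ∧
      ((∀ j ≤ k, w < C.s j ∨ C.e j ≤ w) ∨ ∃ j ≤ k, w = C.s j ∨ w = C.s j + 1) ∧
      w ≠ C.e i ∧ ∀ x, C.s i ≤ x → x < C.e i → x ≠ w →
        (C.G.Adj x w ↔ ¬ C.G.Adj (C.e i) w) := by
    intro i
    by_cases hi : i < k
    · obtain ⟨w, hw⟩ := C.sep' (by omega) i hi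
      exact ⟨w, fun _ => hw⟩
    · exact ⟨0, fun h => absurd h hi⟩
  choose w hw using hsep
  let A : Finset ℕ := ((Finset.range k).image C.e ∪ (Finset.range k).image w).filter
    (fun v => ∀ j ≤ k, v < C.s j ∨ C.e j ≤ v)
  have hAcard : A.card ≤ 2 * k := by
    refine (Finset.card_filter_le _ _).trans ((Finset.card_union_le _ _).trans ?_)
    have h1 := Finset.card_image_le (s := Finset.range k) (f := C.e)
    have h2 := Finset.card_image_le (s := Finset.range k) (f := w)
    rw [Finset.card_range] at h1 h2
    omega
  have hAout : ∀ v ∈ A, ∀ j ≤ k, v < C.s j ∨ C.e j ≤ v := fun v hv =>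
    (Finset.mem_filter.mp hv).2
  have hAN : ∀ v ∈ A, v < C.N := by
    intro v hv
    have := (Finset.mem_filter.mp hv).1
    rw [Finset.mem_union, Finset.mem_image, Finset.mem_image] at this
    rcases this with ⟨i, hi, rfl⟩ | ⟨i, hi, rfl⟩
    · rw [Finset.mem_range] at hi
      have h1 := C.ord i (i+1) (by omega) hi
      have h2 := C.len (i+1) hi
      have h3 := C.top (i+1) hi
      omega
    · exact (hw i (Finset.mem_range.mp hi)).1
  let m := n - A.card - 2 * (k + 1)
  let D := (Finset.range (k+1)).finsuppAntidiag m
  let U : (ℕ →₀ ℕ) → Finset ℕ := fun c => A ∪ (Finset.range (k+1)).biUnion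
    (fun j => Finset.Ico (C.s j) (C.s j + (c j + 2)))
  have hDsum : ∀ c ∈ D, ∑ j ∈ Finset.range (k+1), c j = m := by
    intro c hc
    have := Finset.mem_finsuppAntidiag.mp hc
    exact this.1
  have hDle : ∀ c ∈ D, ∀ j ≤ k, C.s j + (c j + 2) ≤ C.e j := by
    intro c hc j hj
    have h1 := Finset.single_le_sum (f := fun j => c j) (fun i _ => Nat.zero_le _)
      (Finset.mem_range.mpr (Nat.lt_succ_of_le hj))
    rw [hDsum c hc] at h1
    have := C.len j hj
    simp only [m] at h1
    omega
  have hUmem : ∀ c v, v ∈ U c ↔ v ∈ A ∨ ∃ j ≤ k, C.s j ≤ v ∧ v < C.s j + (c j + 2) := by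
    intro c v
    simp only [U, Finset.mem_union, Finset.mem_biUnion, Finset.mem_range, Finset.mem_Ico,
      Nat.lt_succ_iff]
  have hUin : ∀ c ∈ D, ∀ j ≤ k, ∀ v, C.s j ≤ v → v < C.e j →
      (v ∈ U c ↔ v < C.s j + (c j + 2)) := by
    intro c hc j hj v h1 h2
    rw [hUmem]
    constructor
    · rintro (h | ⟨i, hi, h3, h4⟩)
      · have := hAout v h j hj; omega
      · by_cases hij : i = j
        · subst hij; exact h4
        · have := hDle c hc i hi
          have := C.disj j i v hj hi hij h3 (by omega)
          omega
    · intro h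
      exact Or.inr ⟨j, hj, h1, h⟩
  have hUN : ∀ c ∈ D, ∀ v ∈ U c, v < C.N := by
    intro c hc v hv
    rcases (hUmem c v).mp hv with h | ⟨j, hj, h1, h2⟩
    · exact hAN v h
    · have := hDle c hc j hj
      have := C.top j hj
      omega
  have hUcard : ∀ c ∈ D, (U c).card = n := by
    intro c hc
    simp only [U]
    rw [Finset.card_union_of_disjoint, Finset.card_biUnion]
    · simp only [Nat.card_Ico, Nat.add_sub_cancel_left]
      rw [Finset.sum_add_distrib, hDsum c hc]
      simp only [Finset.sum_const, Finset.card_range, smul_eq_mul, m]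
      omega
    · intro i hi j hj hij
      rw [Finset.mem_coe, Finset.mem_range] at hi hj
      simp only [Function.onFun]
      rw [Finset.disjoint_left]
      intro v hv hv'
      rw [Finset.mem_Ico] at hv hv'
      have h1 := hDle c hc i (by omega)
      have h2 := hDle c hc j (by omega)
      have := C.disj j i v (by omega) (by omega) hij hv.1 (by omega)
      omega
    · rw [Finset.disjoint_left]
      intro v hv hv'
      rw [Finset.mem_biUnion] at hv'
      obtain ⟨j, hj, hv'⟩ := hv'
      rw [Finset.mem_range] at hj
      rw [Finset.mem_Ico] at hv'
      have h1 := hDle c hc j (by omega)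
      have := hAout v hv j (by omega)
      omega
  have hUe : ∀ c, ∀ i < k, C.e i ∈ U c := by
    intro c i hi
    rw [hUmem]
    by_cases h : ∀ j ≤ k, C.e i < C.s j ∨ C.e j ≤ C.e i
    · left
      exact Finset.mem_filter.mpr ⟨Finset.mem_union_left _
        (Finset.mem_image_of_mem _ (Finset.mem_range.mpr hi)), h⟩
    · right
      push Not at h
      obtain ⟨j, hj, h1, h2⟩ := h
      refine ⟨j, hj, h1, ?_⟩
      have hij : i < j := by
        by_contra hcon
        have : j < i ∨ j = i := by omega
        rcases this with h3 | h3
        · have := C.ord j i h3 hi.le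
          have := C.len i hi.le
          omega
        · subst h3; omega
      have := C.ord i j hij hj
      omega
  have hUw : ∀ c, ∀ i < k, w i ∈ U c := by
    intro c i hi
    rw [hUmem]
    rcases (hw i hi).2.1 with h | ⟨j, hj, h⟩
    · left
      exact Finset.mem_filter.mpr ⟨Finset.mem_union_right _
        (Finset.mem_image_of_mem _ (Finset.mem_range.mpr hi)), h⟩
    · right
      exact ⟨j, hj, by omega, by omega⟩
  let g : (ℕ →₀ ℕ) → SimpleGraph (Fin n) := fun c =>
    if h : (U c).card = n then C.G.comap ((U c).orderEmbOfFin h) else ⊥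
  have hg : ∀ c (hc : c ∈ D), g c = C.G.comap ((U c).orderEmbOfFin (hUcard c hc)) := by
    intro c hc
    simp only [g]
    rw [dif_pos (hUcard c hc)]
  -- the key step
  have key : ∀ c ∈ D, ∀ c' ∈ D, g c = g c' → ∀ i ≤ k, (∀ j < i, c j = c' j) →
      ¬ c i < c' i := by
    intro c hc c' hc' heq i hi hpre hlt
    have hik : i < k := by
      by_contra hcon
      have hik : i = k := by omega
      have h1 : ∑ j ∈ Finset.range k, c j + c k = m := by
        rw [← Finset.sum_range_succ]; exact hDsum c hc
      have h2 : ∑ j ∈ Finset.range k, c' j + c' k = m := by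
        rw [← Finset.sum_range_succ]; exact hDsum c' hc'
      have h3 : ∑ j ∈ Finset.range k, c j = ∑ j ∈ Finset.range k, c' j :=
        Finset.sum_congr rfl (fun j hj => hpre j (by rw [Finset.mem_range] at hj; omega))
      rw [hik] at hlt
      rw [h3] at h1
      omega
    rw [hg c hc, hg c' hc'] at heq
    have hl := hDle c hc i hi
    have hl' := hDle c' hc' i hi
    obtain ⟨-, -, hwe, hwsep⟩ := hw i hik
    -- below the end of the `i`-th part the two sets agree
    have hagree : ∀ v, v < C.s i + (c i + 2) → (v ∈ U c ↔ v ∈ U c') := by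
      intro v hv
      rw [hUmem, hUmem]
      refine or_congr Iff.rfl (exists_congr fun j => and_congr_right fun hj => ?_)
      rcases lt_trichotomy j i with h | h | h
      · rw [hpre j h]
      · subst h; omega
      · have := C.ord i j h hj
        omega
    obtain ⟨x, hx, hxw⟩ : ∃ x, (x = C.s i ∨ x = C.s i + 1) ∧ x ≠ w i := by
      by_cases h : w i = C.s i
      · exact ⟨C.s i + 1, Or.inr rfl, by omega⟩
      · exact ⟨C.s i, Or.inl rfl, by omega⟩
    have hxU : x ∈ U c := (hUin c hc i hi x (by omega) (by omega)).mpr (by omega)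
    have hxU' : x ∈ U c' := (hUin c' hc' i hi x (by omega) (by omega)).mpr (by omega)
    have hvU' : C.s i + (c i + 2) ∈ U c' :=
      (hUin c' hc' i hi _ (by omega) (by omega)).mpr (by omega)
    obtain ⟨r, hr⟩ := exists_pos (U c) (hUcard c hc) x hxU
    obtain ⟨r', hr'⟩ := exists_pos (U c') (hUcard c' hc') x hxU'
    obtain ⟨p, hp⟩ := exists_pos (U c) (hUcard c hc) (C.e i) (hUe c i hik)
    obtain ⟨p', hp'⟩ := exists_pos (U c') (hUcard c' hc') _ hvU'
    obtain ⟨l, hl0⟩ := exists_pos (U c) (hUcard c hc) (w i) (hUw c i hik)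
    have hrr : r = r' := by
      apply Fin.ext
      rw [← pos_card (U c) (hUcard c hc) r, ← pos_card (U c') (hUcard c' hc') r', hr, hr']
      congr 1
      ext v
      rw [Finset.mem_filter, Finset.mem_filter]
      refine and_congr_left fun hv => hagree v (by omega)
    have hpp : p = p' := by
      apply Fin.ext
      rw [← pos_card (U c) (hUcard c hc) p, ← pos_card (U c') (hUcard c' hc') p', hp, hp']
      congr 1
      ext v
      rw [Finset.mem_filter, Finset.mem_filter]
      constructor
      · rintro ⟨h1, h2⟩
        have h3 : v < C.s i + (c i + 2) := by
          by_contra hcon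
          have := (hUin c hc i hi v (by omega) h2).mp h1
          omega
        exact ⟨(hagree v h3).mp h1, h3⟩
      · rintro ⟨h1, h3⟩
        exact ⟨(hagree v h3).mpr h1, by omega⟩
    subst hrr hpp
    have hlr : l ≠ r := by
      rintro rfl
      rw [hr] at hl0; exact hxw hl0
    have hlp : l ≠ p := by
      rintro rfl
      rw [hp] at hl0; exact hwe hl0.symm
    have a1 : C.G.Adj x (w i) ↔ C.G.Adj x ((U c').orderEmbOfFin (hUcard c' hc') l) := by
      have : (C.G.comap ((U c).orderEmbOfFin (hUcard c hc))).Adj r l ↔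
        (C.G.comap ((U c').orderEmbOfFin (hUcard c' hc'))).Adj r l := by rw [heq]
      rwa [SimpleGraph.comap_adj, SimpleGraph.comap_adj, hr, hr', hl0] at this
    have a2 : C.G.Adj (C.e i) (w i) ↔ C.G.Adj (C.s i + (c i + 2))
        ((U c').orderEmbOfFin (hUcard c' hc') l) := by
      have : (C.G.comap ((U c).orderEmbOfFin (hUcard c hc))).Adj p l ↔
        (C.G.comap ((U c').orderEmbOfFin (hUcard c' hc'))).Adj p l := by rw [heq]
      rwa [SimpleGraph.comap_adj, SimpleGraph.comap_adj, hp, hp', hl0] at this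
    have a3 := C.twin i hi x (C.s i + (c i + 2)) (by omega) (by omega) (by omega) (by omega)
      ((U c').orderEmbOfFin (hUcard c' hc') l)
      (by rw [← hr']; exact fun h => hlr (((U c').orderEmbOfFin (hUcard c' hc')).injective h))
      (by rw [← hp']; exact fun h => hlp (((U c').orderEmbOfFin (hUcard c' hc')).injective h))
    have a4 := hwsep x (by omega) (by omega) hxw
    rw [a1, a2, a3] at a4
    exact iff_not_self a4
  have hinj : Set.InjOn g (D : Set (ℕ →₀ ℕ)) := by
    intro c hc c' hc' heq
    rw [Finset.mem_coe] at hc hc'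
    have all : ∀ i, i ≤ k → c i = c' i := by
      intro i
      induction i using Nat.strong_induction_on with
      | _ i ih =>
        intro hi
        have h1 := key c hc c' hc' heq i hi (fun j hj => ih j hj (by omega))
        have h2 := key c' hc' c hc heq.symm i hi (fun j hj => (ih j hj (by omega)).symm)
        omega
    ext i
    by_cases hi : i ≤ k
    · exact all i hi
    · have z : ∀ c ∈ D, c i = 0 := by
        intro c hc
        have := (Finset.mem_finsuppAntidiag.mp hc).2
        by_contra hne
        have := Finset.mem_range.mp (this (Finsupp.mem_support_iff.mpr hne))
        omega
      rw [z c hc, z c' hc']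
  have hmem : g '' (D : Set (ℕ →₀ ℕ)) ⊆ P.mem n := by
    rintro _ ⟨c, hc, rfl⟩
    rw [Finset.mem_coe] at hc
    rw [hg c hc]
    exact C.sub n _ (fun i => hUN c hc _ (Finset.orderEmbOfFin_mem _ _ _))
  have h1 := Set.ncard_le_ncard hmem (Set.toFinite _)
  rw [Set.ncard_image_of_injOn hinj, Set.ncard_coe_finset,
    Finset.card_finsuppAntidiag_nat_eq_choose, Finset.card_range] at h1
  refine le_trans ?_ h1
  have e1 : k + 1 + m - 1 = k + m := by omega
  rw [e1, ← Nat.choose_symm_add]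
  apply Nat.choose_le_choose
  simp only [m]
  omega

/-- **Lemma (polynomial lower bound).**  If `P` contains graphs whose `(k+1)`-st largest
homogeneous block is arbitrarily large, then `|P_n| ≥ C(n-3k-2, k)` for every `n`,
and moreover if `k = 1` then `|P_n| ≥ n` for every `n`. -/
theorem poly_lower_bound (P : HerProp) (k : ℕ) (hk : 1 ≤ k)
    (h : ∀ M : ℕ, ∃ (N : ℕ) (G : SimpleGraph (Fin N)), G ∈ P.mem N ∧
        ∃ S : Finset (Set (Fin N)), S.card = k + 1 ∧
          ∀ B ∈ S, IsHomBlock G B ∧ M ≤ B.ncard) :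
    (∀ n : ℕ, (n - (3 * k + 2)).choose k ≤ speed P n) ∧
    (k = 1 → ∀ n : ℕ, n ≤ speed P n) := by
  refine ⟨fun n => ?_, ?_⟩
  · obtain ⟨C⟩ := exists_conf P k (n + 2) h
    exact C.main n hk
  · rintro rfl n
    obtain ⟨C⟩ := exists_conf P 1 (n + 2) h
    exact C.k_one n
end

section
/- Let P be a hereditary property of ordered graphs, and suppose that |P_m| < F_m for some m ∈ ℕ. Then there exist integers K, N ∈ ℕ ∪ {0} and integers a_0, …, a_K ∈ ℤ such that |P_n| = Σ_{i=0}^{K} a_i·C(n,i) for every n ≥ N. -/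
open Finset

/-! ## Fibonacci numbers -/

lemma gf_zero : genFib 2 0 = 1 := by rw [genFib]
lemma gf_one : genFib 2 1 = 1 := by
  rw [genFib]; simp [gf_zero]
lemma gf_succ (n : ℕ) : genFib 2 (n + 2) = genFib 2 (n + 1) + genFib 2 n := by
  rw [genFib]; simp [Finset.sum_range_succ]

lemma gf_le_two_pow (n : ℕ) : genFib 2 n ≤ genFib 2 (n + 1) ∧ genFib 2 (n + 1) ≤ 2 ^ n := by
  induction n with
  | zero => simp [gf_zero, gf_one]
  | succ n ih =>
    rw [gf_succ, pow_succ]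
    omega

lemma gf_le_choose (k : ℕ) :
    genFib 2 (2 * k) ≤ (2 * k).choose k ∧ genFib 2 (2 * k + 1) ≤ (2 * k + 1).choose k := by
  induction k with
  | zero => simp [gf_zero, gf_one]
  | succ k ih =>
    obtain ⟨h1, h2⟩ := ih
    have e1 : genFib 2 (2 * (k + 1)) ≤ (2 * (k + 1)).choose (k + 1) := by
      have : 2 * (k + 1) = 2 * k + 1 + 1 := by ring
      rw [this, gf_succ, Nat.choose_succ_succ, Nat.choose_succ_succ (2 * k) k]
      omega
    refine ⟨e1, ?_⟩
    have : 2 * (k + 1) + 1 = (2 * k + 1) + 2 := by ring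
    rw [this, gf_succ, Nat.choose_succ_succ, Nat.succ_eq_add_one]
    have e2 : (2 * k + 1 + 1) = 2 * (k + 1) := by ring
    rw [e2]
    have : (2 * k + 1).choose k ≤ (2 * (k + 1)).choose k := Nat.choose_le_choose k (by omega)
    omega

lemma gf_le_choose' (m : ℕ) : ∃ k l, k + l = m ∧ genFib 2 m ≤ (k + l).choose k := by
  rcases Nat.even_or_odd' m with ⟨k, rfl | rfl⟩
  · refine ⟨k, k, by ring, ?_⟩
    rw [← two_mul]; exact (gf_le_choose k).1
  · refine ⟨k, k + 1, by ring, ?_⟩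
    rw [← add_assoc, ← two_mul]; exact (gf_le_choose k).2

/-- Sparse subsets: no two consecutive elements, all in `[0, n-1)`. -/
lemma sparse_family (n : ℕ) : ∃ (ι : Type) (_ : Fintype ι) (S : ι → ℕ → Prop),
    Fintype.card ι = genFib 2 n ∧ (∀ w w', (∀ i, i + 1 < n → (S w i ↔ S w' i)) → w = w') ∧
    (∀ w i, S w i → ¬ S w (i + 1)) ∧ (∀ w i, S w i → i + 1 < n) := by
  induction n using Nat.strong_induction_on with
  | _ n ih =>
  match n, ih with
  | 0, _ => exact ⟨Unit, inferInstance, fun _ _ => False, by simp [gf_zero], by simp, by simp, by simp⟩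
  | 1, _ => exact ⟨Unit, inferInstance, fun _ _ => False, by simp [gf_one], by simp, by simp, by simp⟩
  | n + 2, ih =>
    obtain ⟨ι, _, S, hc, hi, hs, hb⟩ := ih (n + 1) (by omega)
    obtain ⟨ι', _, S', hc', hi', hs', hb'⟩ := ih n (by omega)
    refine ⟨ι ⊕ ι', inferInstance, fun w i => Sum.elim (fun w => 1 ≤ i ∧ S w (i - 1))
      (fun w => i = 0 ∨ (2 ≤ i ∧ S' w (i - 2))) w, by simp [hc, hc', gf_succ], ?_, ?_, ?_⟩
    · rintro (w | w) (w' | w') h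
      · congr 1; apply hi; intro i hin
        have := h (i + 1) (by omega)
        simpa using this
      · have := h 0 (by omega); simp at this
      · have := h 0 (by omega); simp at this
      · congr 1; apply hi'; intro i hin
        have := h (i + 2) (by omega)
        simpa using this
    · rintro (w | w) i h
      · simp only [Sum.elim_inl] at h ⊢
        rintro ⟨_, h2⟩
        apply hs _ _ h.2
        rwa [show i - 1 + 1 = i + 1 - 1 by omega]
      · simp only [Sum.elim_inr] at h ⊢
        rintro (h1 | ⟨h1, h2⟩)
        · omega
        · rcases h with rfl | ⟨h3, h4⟩
          · omega
          · apply hs' _ _ h4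
            rwa [show i - 2 + 1 = i + 1 - 2 by omega]
    · rintro (w | w) i h
      · simp only [Sum.elim_inl] at h
        have := hb _ _ h.2; omega
      · simp only [Sum.elim_inr] at h
        rcases h with rfl | ⟨h3, h4⟩
        · omega
        · have := hb' _ _ h4; omega

/-- Weakly monotone functions `[0,k) → [0,l]`, extended by `l`. -/
lemma mono_family (k l : ℕ) : ∃ (ι : Type) (_ : Fintype ι) (g : ι → ℕ → ℕ),
    Fintype.card ι = (k + l).choose k ∧ (∀ w w', (∀ p, p < k → g w p = g w' p) → w = w') ∧
    (∀ w p q, p ≤ q → g w p ≤ g w q) ∧ (∀ w p, g w p ≤ l) ∧ (∀ w p, k ≤ p → g w p = l) := by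
  induction k generalizing l with
  | zero => exact ⟨Unit, inferInstance, fun _ _ => l, by simp, by simp, by simp, by simp, by simp⟩
  | succ k ihk =>
    induction l with
    | zero => exact ⟨Unit, inferInstance, fun _ _ => 0, by simp, by simp, by simp, by simp, by simp⟩
    | succ l ihl =>
      obtain ⟨ι, _, g, hc, hi, hm, hb, he⟩ := ihk (l + 1)
      obtain ⟨ι', _, g', hc', hi', hm', hb', he'⟩ := ihl
      refine ⟨ι ⊕ ι', inferInstance, fun w p => Sum.elim (fun w => if p = 0 then 0 else g w (p - 1))
        (fun w => g' w p + 1) w, ?_, ?_, ?_, ?_, ?_⟩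
      · rw [Fintype.card_sum, hc, hc', show k + 1 + (l + 1) = (k + (l + 1)) + 1 by ring,
          Nat.choose_succ_succ, show k + 1 + l = k + (l + 1) by ring]
      · rintro (w | w) (w' | w') h
        · congr 1; apply hi; intro i hin
          have := h (i + 1) (by omega)
          simpa using this
        · have := h 0 (by omega); simp at this
        · have := h 0 (by omega); simp at this
        · congr 1; apply hi'; intro i hin
          have := h i (by omega)
          simpa using this
      · rintro (w | w) p q hpq
        · simp only [Sum.elim_inl]
          split_ifs with h1 h2
          · omega
          · omega
          · omega
          · apply hm; omega
        · simp only [Sum.elim_inr]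
          have := hm' w p q hpq; omega
      · rintro (w | w) p
        · simp only [Sum.elim_inl]
          split_ifs
          · omega
          · apply hb
        · simp only [Sum.elim_inr]
          have := hb' w p; omega
      · rintro (w | w) p hp
        · simp only [Sum.elim_inl]
          rw [if_neg (by omega)]
          apply he; omega
        · simp only [Sum.elim_inr]
          rw [he' w p hp]

/-! ## Lower bounds on the speed -/

lemma speed_ge {P : HerProp} {N : ℕ} {G : SimpleGraph (Fin N)} (hG : G ∈ P.mem N) {m : ℕ}
    {ι : Type} [Fintype ι] (φ : ι → Fin m → Fin N) (hφ : ∀ w, StrictMono (φ w))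
    (hinj : ∀ w w', (∀ i j, G.Adj (φ w i) (φ w j) ↔ G.Adj (φ w' i) (φ w' j)) → w = w') :
    Fintype.card ι ≤ speed P m := by
  have h1 : (Set.range fun w => G.comap (φ w)) ⊆ P.mem m := by
    rintro _ ⟨w, rfl⟩
    exact P.hered _ G ⟨OrderEmbedding.ofStrictMono (φ w) (hφ w), fun i j => Iff.rfl⟩ hG
  have h2 := Set.ncard_le_ncard h1 (Set.toFinite _)
  rw [Set.ncard_range_of_injective] at h2
  · simpa [speed, Nat.card_eq_fintype_card] using h2
  · intro w w' h
    apply hinj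
    intro i j
    have := congrArg (fun H : SimpleGraph (Fin m) => H.Adj i j) h
    simpa using this

/-- Type 1, with the special vertex on the left. -/
lemma type1L {P : HerProp} {N : ℕ} {G : SimpleGraph (Fin N)} (hG : G ∈ P.mem N) (m : ℕ)
    (y : Fin N) (a b : ℕ → Fin N) (hab : ∀ i, i < m → a i < b i)
    (hba : ∀ i j, i < j → j < m → b i < a j) (hy : ∀ i, i < m → y < a i)
    (hd : ∀ i, i < m → ¬ (G.Adj y (a i) ↔ G.Adj y (b i))) :
    genFib 2 (m + 1) ≤ speed P (m + 1) := by
  classical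
  refine (gf_le_two_pow m).2.trans ?_
  have hc : Fintype.card (Fin m → Bool) = 2 ^ m := by simp
  rw [← hc]
  let z : (Fin m → Bool) → Fin m → Fin N := fun w i =>
    if (decide (G.Adj y (a i)) = w i) then a i else b i
  have hz : ∀ w i, z w i = a i ∨ z w i = b i := by
    intro w i; simp only [z]; split_ifs <;> simp
  have hzw : ∀ w i, decide (G.Adj y (z w i)) = w i := by
    intro w i
    have := hd i i.2
    simp only [z]
    split_ifs with h
    · exact h
    · by_cases h1 : G.Adj y (a i) <;> by_cases h2 : G.Adj y (b i) <;> simp_all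
  refine speed_ge hG (fun w => Fin.cons y (z w)) ?_ ?_
  · intro w i j hij
    induction i using Fin.cases with
    | zero =>
      induction j using Fin.cases with
      | zero => simp at hij
      | succ j =>
        simp only [Fin.cons_zero, Fin.cons_succ]
        rcases hz w j with h | h <;> rw [h]
        · exact hy _ j.2
        · exact (hy _ j.2).trans (hab _ j.2)
    | succ i =>
      induction j using Fin.cases with
      | zero => simp at hij
      | succ j =>
        simp only [Fin.cons_succ]
        have hij' : (i : ℕ) < j := by simpa using hij
        have h3 := hba _ _ hij' j.2
        have h4 := hab _ i.2
        have h5 := hab _ j.2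
        rcases hz w i with h | h <;> rcases hz w j with h' | h' <;> rw [h, h'] <;> omega
  · intro w w' h
    funext i
    rw [← hzw w i, ← hzw w' i]
    have := h 0 i.succ
    simp only [Fin.cons_zero, Fin.cons_succ] at this
    simp [this]

/-- Type 1, with the special vertex on the right. -/
lemma type1R {P : HerProp} {N : ℕ} {G : SimpleGraph (Fin N)} (hG : G ∈ P.mem N) (m : ℕ)
    (y : Fin N) (a b : ℕ → Fin N) (hab : ∀ i, i < m → a i < b i)
    (hba : ∀ i j, i < j → j < m → b i < a j) (hy : ∀ i, i < m → b i < y)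
    (hd : ∀ i, i < m → ¬ (G.Adj y (a i) ↔ G.Adj y (b i))) :
    genFib 2 (m + 1) ≤ speed P (m + 1) := by
  classical
  refine (gf_le_two_pow m).2.trans ?_
  have hc : Fintype.card (Fin m → Bool) = 2 ^ m := by simp
  rw [← hc]
  let z : (Fin m → Bool) → Fin m → Fin N := fun w i =>
    if (decide (G.Adj y (a i)) = w i) then a i else b i
  have hz : ∀ w i, z w i = a i ∨ z w i = b i := by
    intro w i; simp only [z]; split_ifs <;> simp
  have hzw : ∀ w i, decide (G.Adj y (z w i)) = w i := by
    intro w i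
    have := hd i i.2
    simp only [z]
    split_ifs with h
    · exact h
    · by_cases h1 : G.Adj y (a i) <;> by_cases h2 : G.Adj y (b i) <;> simp_all
  refine speed_ge hG (fun w => Fin.snoc (α := fun _ => Fin N) (z w) y) ?_ ?_
  · intro w i j hij
    induction j using Fin.lastCases with
    | last =>
      induction i using Fin.lastCases with
      | last => simp at hij
      | cast i =>
        simp only [Fin.snoc_last, Fin.snoc_castSucc]
        rcases hz w i with h | h <;> rw [h]
        · exact (hab _ i.2).trans (hy _ i.2)
        · exact hy _ i.2
    | cast j =>
      induction i using Fin.lastCases with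
      | last => exact absurd hij (by simp [Fin.le_last])
      | cast i =>
        simp only [Fin.snoc_castSucc]
        have hij' : (i : ℕ) < j := by simpa using hij
        have h3 := hba _ _ hij' j.2
        have h4 := hab _ i.2
        have h5 := hab _ j.2
        rcases hz w i with h | h <;> rcases hz w j with h' | h' <;> rw [h, h'] <;> omega
  · intro w w' h
    funext i
    rw [← hzw w i, ← hzw w' i]
    have := h (Fin.last m) i.castSucc
    simp only [Fin.snoc_last, Fin.snoc_castSucc] at this
    simp [this]

/-- Type 3, fully homogeneous. -/
lemma type3 {P : HerProp} {N : ℕ} {G : SimpleGraph (Fin N)} (hG : G ∈ P.mem N) (m : ℕ)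
    (x y : ℕ → Fin N) (hxy : ∀ i, i < m → x i < y i) (hyx : ∀ i j, i < j → j < m → y i < x j)
    (c : Prop) (hd : ∀ i, i < m → (G.Adj (x i) (y i) ↔ ¬ c))
    (h1 : ∀ i j, i < j → j < m → (G.Adj (x i) (x j) ↔ c))
    (h3 : ∀ i j, i < j → j < m → (G.Adj (y i) (x j) ↔ c)) :
    genFib 2 m ≤ speed P m := by
  classical
  obtain ⟨ι, _, S, hcard, hi, hs, hb⟩ := sparse_family m
  rw [← hcard]
  let φ : ι → ℕ → Fin N := fun w i => if 1 ≤ i ∧ S w (i - 1) then y (i - 1) else x i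
  have hφ : ∀ w i j, i < j → j < m → φ w i < φ w j := by
    intro w i j hij hj
    have e1 := hxy i (by omega)
    have e2 := hyx i j hij hj
    have e3 := hxy j hj
    simp only [φ]
    split_ifs with hA hB hB
    · have := hyx (i - 1) (j - 1) (by omega) (by omega)
      have := hxy (j - 1) (by omega)
      omega
    · have := hyx (i - 1) j (by omega) (by omega)
      omega
    · rcases Nat.lt_or_ge i (j - 1) with h | h
      · have := hyx i (j - 1) (by omega) (by omega)
        have := hxy (j - 1) (by omega)
        omega
      · have : i = j - 1 := by omega
        subst this
        exact e1
    · omega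
  refine speed_ge hG (fun w i => φ w i) ?_ ?_
  · intro w i j hij
    exact hφ w i j hij j.2
  · intro w w' h
    have key : ∀ w i, i + 1 < m → (S w i ↔ ¬ (G.Adj (φ w i) (φ w (i + 1)) ↔ c)) := by
      intro w i hi
      by_cases hS : S w i
      · simp only [hS, true_iff]
        have hn : ¬ (1 ≤ i ∧ S w (i - 1)) := by
          rintro ⟨h1, h2⟩
          apply hs _ _ h2
          rwa [Nat.sub_add_cancel h1]
        simp only [φ, hn, if_false, Nat.add_sub_cancel, hS, and_true,
          show 1 ≤ i + 1 by omega, if_true]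
        rw [hd i (by omega)]
        tauto
      · simp only [hS, false_iff, not_not]
        have hn : ¬ (1 ≤ i + 1 ∧ S w (i + 1 - 1)) := by simpa using hS
        simp only [φ, hn, if_false]
        split_ifs with h
        · exact h3 _ _ (by omega) hi
        · exact h1 _ _ (by omega) hi
    apply hi
    intro i hi
    rw [key w i hi, key w' i hi]
    have := h ⟨i, by omega⟩ ⟨i + 1, hi⟩
    simp only at this
    rw [this]

/-- Type 2, core counting. -/
lemma type2_core {P : HerProp} {N : ℕ} {G : SimpleGraph (Fin N)} (hG : G ∈ P.mem N) (k l : ℕ)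
    {ι : Type} [Fintype ι] (a : ι → ℕ → Fin N) (b : ℕ → Fin N)
    (ha : ∀ w i j, i < j → j < k → a w i < a w j) (hb : ∀ i j, i < j → j < l → b i < b j)
    (hab : ∀ w i j, i < k → j < l → a w i < b j)
    (hinj : ∀ w w', (∀ p q, p < k → q < l → (G.Adj (a w p) (b q) ↔ G.Adj (a w' p) (b q))) →
      w = w') :
    Fintype.card ι ≤ speed P (k + l) := by
  refine speed_ge hG (fun w i => if (i : ℕ) < k then a w i else b (i - k)) ?_ ?_
  · intro w i j hij
    have hij' : (i : ℕ) < j := hij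
    have := j.2
    simp only
    split_ifs with h1 h2 h2
    · exact ha _ _ _ hij' h2
    · exact hab _ _ _ h1 (by omega)
    · omega
    · exact hb _ _ (by omega) (by omega)
  · intro w w' h
    apply hinj
    intro p q hp hq
    have := h ⟨p, by omega⟩ ⟨k + q, by omega⟩
    simpa [hp] using this

/-- The two pieces of a two-sided arrangement. -/
lemma type2_arr {P : HerProp} {N : ℕ} {G : SimpleGraph (Fin N)} (hG : G ∈ P.mem N) (k l : ℕ)
    {ι : Type} [Fintype ι] (T : ℕ) (x y : ℕ → Fin N)
    (hx : ∀ i j, i < j → j < T → x i < x j)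
    (hy : (∀ i j, i < j → j < T → y i < y j) ∨ (∀ i j, i < j → j < T → y j < y i))
    (hxy : ∀ i j, i < T → j < T → x i < y j)
    (α : ι → ℕ → ℕ) (β : ℕ → ℕ) (hα : ∀ w i j, i < j → j < k → α w i < α w j)
    (hαT : ∀ w i, i < k → α w i < T)
    (hβ : ∀ i j, i < j → j < l → β i < β j) (hβT : ∀ i, i < l → β i < T)
    (hinj : ∀ w w', (∀ p q, p < k → q < l →
      (G.Adj (x (α w p)) (y (β q)) ↔ G.Adj (x (α w' p)) (y (β q)))) → w = w') :
    Fintype.card ι ≤ speed P (k + l) := by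
  rcases hy with hy | hy
  · refine type2_core hG k l (fun w p => x (α w p)) (fun q => y (β q)) ?_ ?_ ?_ hinj
    · exact fun w i j hij hj => hx _ _ (hα w i j hij hj) (hαT w j hj)
    · exact fun i j hij hj => hy _ _ (hβ i j hij hj) (hβT j hj)
    · exact fun w i j hi hj => hxy _ _ (hαT w i hi) (hβT j hj)
  · refine type2_core hG k l (fun w p => x (α w p)) (fun q => y (β (l - 1 - q))) ?_ ?_ ?_ ?_
    · exact fun w i j hij hj => hx _ _ (hα w i j hij hj) (hαT w j hj)
    · exact fun i j hij hj => hy _ _ (hβ _ _ (by omega) (by omega)) (hβT _ (by omega))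
    · exact fun w i j hi hj => hxy _ _ (hαT w i hi) (hβT _ (by omega))
    · intro w w' h
      apply hinj
      intro p q hp hq
      have := h p (l - 1 - q) hp (by omega)
      simp only [show l - 1 - (l - 1 - q) = q by omega] at this
      exact this

lemma blk_lt {k g q : ℕ} (r s : ℕ) (hr : r ≤ k) (h : g < q) :
    g * (k + 1) + r < q * (k + 1) + s := by
  have : (g + 1) * (k + 1) ≤ q * (k + 1) := Nat.mul_le_mul_right _ h
  nlinarith

lemma type2_half {P : HerProp} {N : ℕ} {G : SimpleGraph (Fin N)} (hG : G ∈ P.mem N) (m : ℕ)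
    (T : ℕ) (hT : (m + 1) * (m + 1) ≤ T) (x y : ℕ → Fin N)
    (hx : ∀ i j, i < j → j < T → x i < x j)
    (hy : (∀ i j, i < j → j < T → y i < y j) ∨ (∀ i j, i < j → j < T → y j < y i))
    (hxy : ∀ i j, i < T → j < T → x i < y j) (c : Prop)
    (h1 : ∀ i j, i < j → j < T → (G.Adj (x i) (y j) ↔ c))
    (h2 : ∀ i j, i < j → j < T → (G.Adj (x j) (y i) ↔ ¬ c)) :
    genFib 2 m ≤ speed P m := by
  obtain ⟨k, l, rfl, hkl⟩ := gf_le_choose' m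
  obtain ⟨ι, _, g, hc, hi, hm, hb, he⟩ := mono_family k l
  refine hkl.trans ?_
  rw [← hc]
  have hT' : (l + 1) * (k + 1) ≤ T := le_trans (Nat.mul_le_mul (by omega) (by omega)) hT
  have hTa : ∀ w i, i < k → g w i * (k + 1) + i < T := by
    intro w i hik
    have := blk_lt (k := k) (g := g w i) (q := l + 1) i 0 (by omega) (by have := hb w i; omega)
    omega
  have hTb : ∀ i, i < l → i * (k + 1) + k < T := by
    intro i hil
    have := blk_lt (k := k) (g := i) (q := l + 1) k 0 (by omega) (by omega)
    omega
  refine type2_arr hG k l T x y hx hy hxy (fun w p => g w p * (k + 1) + p)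
    (fun q => q * (k + 1) + k) ?_ hTa ?_ hTb ?_
  · intro w i j hij hj
    rcases (hm w i j hij.le).lt_or_eq with h | h
    · exact blk_lt _ _ (by omega) h
    · rw [h]; omega
  · intro i j hij hj
    exact blk_lt _ _ le_rfl hij
  · intro w w' h
    apply hi
    intro p hp
    have key : ∀ w q, q < l → ((G.Adj (x (g w p * (k + 1) + p)) (y (q * (k + 1) + k)) ↔ c) ↔
        g w p ≤ q) := by
      intro w q hq
      rcases Nat.lt_or_ge q (g w p) with hlt | hge
      · rw [h2 _ _ (blk_lt k p le_rfl hlt) (hTa w p hp)]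
        have : ¬ (g w p ≤ q) := by omega
        tauto
      · have hl : g w p * (k + 1) + p < q * (k + 1) + k := by
          rcases hge.lt_or_eq with h | h
          · exact blk_lt _ _ (by omega) h
          · rw [h]; omega
        rw [h1 _ _ hl (hTb q hq)]
        tauto
    have key2 : ∀ q, q < l → (g w p ≤ q ↔ g w' p ≤ q) := by
      intro q hq
      rw [← key w q hq, ← key w' q hq]
      have := h p q hp hq
      rw [this]
    have b1 := hb w p
    have b2 := hb w' p
    rcases lt_trichotomy (g w p) (g w' p) with h | h | h
    · have := key2 (g w p) (by omega); omega
    · exact h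
    · have := key2 (g w' p) (by omega); omega

lemma type2_match {P : HerProp} {N : ℕ} {G : SimpleGraph (Fin N)} (hG : G ∈ P.mem N) (m : ℕ)
    (T : ℕ) (hT : (m + 1) * (m + 1) ≤ T) (x y : ℕ → Fin N)
    (hx : ∀ i j, i < j → j < T → x i < x j)
    (hy : (∀ i j, i < j → j < T → y i < y j) ∨ (∀ i j, i < j → j < T → y j < y i))
    (hxy : ∀ i j, i < T → j < T → x i < y j) (c : Prop)
    (h1 : ∀ i j, i < j → j < T → (G.Adj (x i) (y j) ↔ c))
    (h2 : ∀ i j, i < j → j < T → (G.Adj (x j) (y i) ↔ c))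
    (h3 : ∀ i, i < T → (G.Adj (x i) (y i) ↔ ¬ c)) :
    genFib 2 m ≤ speed P m := by
  obtain ⟨k, l, rfl, hkl⟩ := gf_le_choose' m
  obtain ⟨ι, _, g, hc, hi, hm, hb, he⟩ := mono_family k l
  refine hkl.trans ?_
  rw [← hc]
  have hT' : (l + 1) * (k + 1) ≤ T := le_trans (Nat.mul_le_mul (by omega) (by omega)) hT
  let off : ι → ℕ → ℕ := fun w p => if g w p < g w (p + 1) then k else p
  have hoff : ∀ w p, p < k → off w p ≤ k := by
    intro w p hp; simp only [off]; split_ifs <;> omega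
  have hTa : ∀ w i, i < k → g w i * (k + 1) + off w i < T := by
    intro w i hik
    have := blk_lt (k := k) (g := g w i) (q := l + 1) (off w i) 0 (hoff w i hik)
      (by have := hb w i; omega)
    omega
  have hTb : ∀ i, i < l → i * (k + 1) + k < T := by
    intro i hil
    have := blk_lt (k := k) (g := i) (q := l + 1) k 0 (by omega) (by omega)
    omega
  refine type2_arr hG k l T x y hx hy hxy (fun w p => g w p * (k + 1) + off w p)
    (fun q => q * (k + 1) + k) ?_ hTa ?_ hTb ?_
  · intro w i j hij hj
    rcases (hm w i j hij.le).lt_or_eq with h | h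
    · exact blk_lt _ _ (hoff w i (by omega)) h
    · have e1 := hm w i (i + 1) (by omega)
      have e2 := hm w (i + 1) j (by omega)
      have : off w i = i := by simp only [off]; rw [if_neg (by omega)]
      rw [this, h]
      have : i < off w j := by simp only [off]; split_ifs <;> omega
      omega
  · intro i j hij hj
    exact blk_lt _ _ le_rfl hij
  · intro w w' h
    have key : ∀ w p q, p < k → q < l →
        ((G.Adj (x (g w p * (k + 1) + off w p)) (y (q * (k + 1) + k)) ↔ ¬ c) ↔
        (g w p = q ∧ g w p < g w (p + 1))) := by
      intro w p q hp hq
      rcases lt_trichotomy (g w p) q with hlt | heq | hgt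
      · rw [h1 _ _ (blk_lt _ k (hoff w p hp) hlt) (hTb q hq)]
        have : ¬ (g w p = q) := by omega
        tauto
      · by_cases hs : g w p < g w (p + 1)
        · have : off w p = k := by simp only [off]; rw [if_pos hs]
          rw [this, heq, h3 _ (hTb q hq)]
          have : q < g w (p + 1) := by omega
          tauto
        · have : off w p = p := by simp only [off]; rw [if_neg hs]
          rw [this, heq, h1 _ _ (by omega) (hTb q hq)]
          have : ¬ q < g w (p + 1) := by omega
          tauto
      · rw [h2 _ _ (blk_lt k _ le_rfl hgt) (hTa w p hp)]
        have : ¬ (g w p = q) := by omega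
        tauto
    have key2 : ∀ p q, p < k → q < l → ((g w p = q ∧ g w p < g w (p + 1)) ↔
        (g w' p = q ∧ g w' p < g w' (p + 1))) := by
      intro p q hp hq
      rw [← key w p q hp hq, ← key w' p q hp hq]
      have := h p q hp hq
      rw [this]
    have main : ∀ d p, p + d = k → g w p = g w' p := by
      intro d
      induction d with
      | zero => intro p hp; rw [he w p (by omega), he w' p (by omega)]
      | succ d ih =>
        intro p hp
        have e := ih (p + 1) (by omega)
        have m1 := hm w p (p + 1) (by omega)
        have m2 := hm w' p (p + 1) (by omega)
        have b1 := hb w (p + 1)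
        have b2 := hb w' (p + 1)
        by_cases hs : g w p < g w (p + 1)
        · have := key2 p (g w p) (by omega) (by omega)
          omega
        · by_cases hs' : g w' p < g w' (p + 1)
          · have := key2 p (g w' p) (by omega) (by omega)
            omega
          · omega
    intros
    apply hi
    intro p hp
    exact main (k - p) p (by omega)

/-! ## Ramsey's theorem for pairs -/

lemma exists_enum (S : Finset ℕ) (T : ℕ) (h : T ≤ S.card) : ∃ s : ℕ → ℕ,
    (∀ i, i < T → s i ∈ S) ∧ (∀ i j, i < j → j < T → s i < s j) := by
  let e := S.orderEmbOfCardLe h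
  refine ⟨fun i => if hi : i < T then e ⟨i, hi⟩ else 0, ?_, ?_⟩
  · intro i hi
    simp only [hi, dif_pos]
    exact Finset.orderEmbOfCardLe_mem S h _
  · intro i j hij hj
    simp only [hj, hij.trans hj, dif_pos]
    exact e.strictMono hij

lemma end_homog (κ : Type) [Finite κ] (T : ℕ) : ∃ R : ℕ, ∀ f : ℕ → ℕ → κ, ∀ S : Finset ℕ,
    R ≤ S.card → ∃ s : ℕ → ℕ, (∀ i, i < T → s i ∈ S) ∧ (∀ i j, i < j → j < T → s i < s j) ∧
    ∃ c : ℕ → κ, ∀ i j, i < j → j < T → f (s i) (s j) = c i := by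
  classical
  have := Fintype.ofFinite κ
  induction T with
  | zero => exact ⟨0, fun f S _ => ⟨id, by simp, by simp, fun i => f i i, by simp⟩⟩
  | succ T ih =>
    obtain ⟨R, hR⟩ := ih
    refine ⟨Fintype.card κ * R + 1, fun f S hS => ?_⟩
    have hne : S.Nonempty := by rw [← Finset.card_pos]; omega
    set x := S.min' hne with hx
    have hcard : Fintype.card κ * R ≤ (S.erase x).card := by
      rw [Finset.card_erase_of_mem (S.min'_mem hne)]; omega
    have : Nonempty κ := ⟨f 0 0⟩
    obtain ⟨c0, -, hc0⟩ := Finset.exists_le_card_fiber_of_mul_le_card_of_maps_to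
      (s := S.erase x) (t := (Finset.univ : Finset κ)) (f := fun z => f x z) (n := R)
      (fun _ _ => Finset.mem_univ _) Finset.univ_nonempty (by simpa using hcard)
    obtain ⟨s, hs1, hs2, c, hc⟩ := hR f _ hc0
    have hmem : ∀ i, i < T → s i ∈ S ∧ x < s i ∧ f x (s i) = c0 := by
      intro i hi
      have := hs1 i hi
      simp only [Finset.mem_filter, Finset.mem_erase] at this
      refine ⟨this.1.2, ?_, this.2⟩
      exact lt_of_le_of_ne (S.min'_le _ this.1.2) (Ne.symm this.1.1)
    refine ⟨fun i => if i = 0 then x else s (i - 1), ?_, ?_,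
      fun i => if i = 0 then c0 else c (i - 1), ?_⟩
    · intro i hi
      simp only
      split_ifs with h
      · exact S.min'_mem hne
      · exact (hmem (i - 1) (by omega)).1
    · intro i j hij hj
      simp only [show j ≠ 0 by omega, if_false]
      split_ifs with h
      · exact (hmem (j - 1) (by omega)).2.1
      · exact hs2 _ _ (by omega) (by omega)
    · intro i j hij hj
      simp only [show j ≠ 0 by omega, if_false]
      split_ifs with h
      · exact (hmem (j - 1) (by omega)).2.2
      · exact hc _ _ (by omega) (by omega)

lemma ramsey_pairs (κ : Type) [Finite κ] (T : ℕ) : ∃ R : ℕ, ∀ f : ℕ → ℕ → κ,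
    ∃ s : ℕ → ℕ, (∀ i, i < T → s i < R) ∧ (∀ i j, i < j → j < T → s i < s j) ∧
    ∃ c : κ, ∀ i j, i < j → j < T → f (s i) (s j) = c := by
  classical
  have := Fintype.ofFinite κ
  obtain ⟨R, hR⟩ := end_homog κ (Fintype.card κ * T)
  refine ⟨R, fun f => ?_⟩
  obtain ⟨s, hs1, hs2, c, hc⟩ := hR f (Finset.range R) (by simp)
  have : Nonempty κ := ⟨f 0 0⟩
  obtain ⟨c0, -, hc0⟩ := Finset.exists_le_card_fiber_of_mul_le_card_of_maps_to
      (s := Finset.range (Fintype.card κ * T)) (t := (Finset.univ : Finset κ)) (f := c) (n := T)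
      (fun _ _ => Finset.mem_univ _) Finset.univ_nonempty (by simp)
  obtain ⟨e, he1, he2⟩ := exists_enum _ T hc0
  have hmem : ∀ i, i < T → e i < Fintype.card κ * T ∧ c (e i) = c0 := by
    intro i hi
    simpa using he1 i hi
  refine ⟨fun i => s (e i), ?_, ?_, c0, ?_⟩
  · intro i hi
    simpa using hs1 _ (hmem i hi).1
  · intro i j hij hj
    exact hs2 _ _ (he2 i j hij hj) (hmem j hj).1
  · intro i j hij hj
    rw [hc _ _ (he2 i j hij hj) (hmem j hj).1, (hmem i (hij.trans hj)).2]

/-! ## Few breaks -/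

/-- Position `i` is a break witnessed by a vertex to the right of `i+1`. -/
def RB {N : ℕ} (G : SimpleGraph (Fin N)) (i : ℕ) : Prop :=
  ∃ a b v : Fin N, (a : ℕ) = i ∧ (b : ℕ) = i + 1 ∧ b < v ∧ ¬ (G.Adj v a ↔ G.Adj v b)

/-- Position `i` is a break witnessed by a vertex to the left of `i`. -/
def LB {N : ℕ} (G : SimpleGraph (Fin N)) (i : ℕ) : Prop :=
  ∃ a b v : Fin N, (a : ℕ) = i ∧ (b : ℕ) = i + 1 ∧ v < a ∧ ¬ (G.Adj v a ↔ G.Adj v b)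

set_option maxHeartbeats 2000000 in
lemma homog_case {P : HerProp} {N : ℕ} {G : SimpleGraph (Fin N)} (hG : G ∈ P.mem N) (m T : ℕ)
    (hm : 1 ≤ m) (hT : (m + 1) * (m + 1) + 3 ≤ T) (a b v : ℕ → Fin N)
    (hab : ∀ i, i < T → a i < b i) (hbv : ∀ i, i < T → b i < v i)
    (hba : ∀ i j, i < j → j < T → b i < a j)
    (hd : ∀ i, i < T → ¬ (G.Adj (v i) (a i) ↔ G.Adj (v i) (b i)))
    (O1 O3 O4 Maa Mav Mva Mbb Mbv Mvb U : Prop)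
    (hO1 : ∀ i j, i < j → j < T → (v i < a j ↔ O1))
    (hO3 : ∀ i j, i < j → j < T → (v i < v j ↔ O3))
    (hO4 : ∀ i j, i < j → j < T → (v j < v i ↔ O4))
    (haa : ∀ i j, i < j → j < T → (G.Adj (a i) (a j) ↔ Maa))
    (hav : ∀ i j, i < j → j < T → (G.Adj (a i) (v j) ↔ Mav))
    (hva : ∀ i j, i < j → j < T → (G.Adj (v i) (a j) ↔ Mva))
    (hbb : ∀ i j, i < j → j < T → (G.Adj (b i) (b j) ↔ Mbb))
    (hbv' : ∀ i j, i < j → j < T → (G.Adj (b i) (v j) ↔ Mbv))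
    (hvb : ∀ i j, i < j → j < T → (G.Adj (v i) (b j) ↔ Mvb))
    (hU : ∀ i j, i < j → j < T → (G.Adj (a i) (v i) ↔ U)) :
    genFib 2 m ≤ speed P m := by
  have hmT : m + 3 ≤ T := by nlinarith
  obtain ⟨n, rfl⟩ : ∃ n, m = n + 1 := ⟨m - 1, by omega⟩
  have hUa : ∀ i, i + 1 < T → (G.Adj (a i) (v i) ↔ U) := fun i hi => hU i (i + 1) (by omega) hi
  have hUb : ∀ i, i + 1 < T → (G.Adj (b i) (v i) ↔ ¬ U) := by
    intro i hi
    have h1 := hUa i hi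
    have h2 := hd i (by omega)
    rw [G.adj_comm (v i), G.adj_comm (v i)] at h2
    tauto
  by_cases h1 : O1
  · -- disjoint intervals
    simp only [h1, iff_true] at hO1
    by_cases hA : Maa ↔ Mva
    swap
    · refine type1R hG n (a n) a v (fun i hi => (hab i (by omega)).trans (hbv i (by omega)))
        (fun i j hij hj => hO1 i j hij (by omega)) (fun i hi => hO1 i n hi (by omega)) ?_
      intro i hi
      rw [G.adj_comm (a n), G.adj_comm (a n), haa i n hi (by omega), hva i n hi (by omega)]
      exact hA
    by_cases hB : Mbb ↔ Mvb
    swap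
    · refine type1R hG n (b n) b v (fun i hi => (hbv i (by omega)))
        (fun i j hij hj => (hO1 i j hij (by omega)).trans (hab j (by omega)))
        (fun i hi => (hO1 i n hi (by omega)).trans (hab n (by omega))) ?_
      intro i hi
      rw [G.adj_comm (b n), G.adj_comm (b n), hbb i n hi (by omega), hvb i n hi (by omega)]
      exact hB
    by_cases hAU : U ↔ Maa
    swap
    · refine type3 hG (n + 1) a v (fun i hi => (hab i (by omega)).trans (hbv i (by omega)))
        (fun i j hij hj => hO1 i j hij (by omega)) Maa ?_ ?_ ?_
      · intro i hi; rw [hUa i (by omega)]; tauto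
      · intro i j hij hj; exact haa i j hij (by omega)
      · intro i j hij hj; rw [hva i j hij (by omega)]; tauto
    by_cases hBU : ¬ U ↔ Mbb
    swap
    · refine type3 hG (n + 1) b v (fun i hi => (hbv i (by omega)))
        (fun i j hij hj => (hO1 i j hij (by omega)).trans (hab j (by omega))) Mbb ?_ ?_ ?_
      · intro i hi; rw [hUb i (by omega)]; tauto
      · intro i j hij hj; exact hbb i j hij (by omega)
      · intro i j hij hj; rw [hvb i j hij (by omega)]; tauto
    refine type1L hG n (v 0) (fun i => a (i + 1)) (fun i => b (i + 1))
      (fun i hi => hab _ (by omega)) (fun i j hij hj => hba _ _ (by omega) (by omega))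
      (fun i hi => hO1 _ _ (by omega) (by omega)) ?_
    intro i hi
    rw [hva 0 (i + 1) (by omega) (by omega), hvb 0 (i + 1) (by omega) (by omega)]
    tauto
  · simp only [h1, iff_false, not_lt] at hO1
    -- all `a`, `b` lie to the left of all `v`
    have hbv2 : ∀ i j, i < T - 1 → j < T - 1 → b i < v j := by
      intro i j hi hj
      rcases lt_trichotomy i j with h | h | h
      · have e1 := hba i j h (by omega)
        have e2 := hab j (by omega)
        have e3 := hbv j (by omega)
        omega
      · subst h; exact hbv i (by omega)
      · have e1 := hO1 j (i + 1) (by omega) (by omega)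
        have e2 := hba i (i + 1) (by omega) (by omega)
        omega
    have hav2 : ∀ i j, i < T - 1 → j < T - 1 → a i < v j := fun i j hi hj =>
      (hab i (by omega)).trans (hbv2 i j hi hj)
    have haa2 : ∀ i j, i < j → j < T - 1 → a i < a j := fun i j hij hj =>
      (hab i (by omega)).trans (hba i j hij (by omega))
    have hbb2 : ∀ i j, i < j → j < T - 1 → b i < b j := fun i j hij hj =>
      (hba i j hij (by omega)).trans (hab j (by omega))
    have hTT : (n + 1 + 1) * (n + 1 + 1) ≤ T - 1 := by omega
    by_cases hO : O3 ∨ O4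
    · have hy : (∀ i j, i < j → j < T - 1 → v i < v j) ∨
          (∀ i j, i < j → j < T - 1 → v j < v i) := by
        rcases hO with h | h
        · left; intro i j hij hj; exact (hO3 i j hij (by omega)).2 h
        · right; intro i j hij hj; exact (hO4 i j hij (by omega)).2 h
      by_cases hA : Mav ↔ Mva
      swap
      · refine type2_half hG (n + 1) (T - 1) hTT a v haa2 hy hav2 Mav ?_ ?_
        · intro i j hij hj; exact hav i j hij (by omega)
        · intro i j hij hj; rw [G.adj_comm, hva i j hij (by omega)]; tauto
      by_cases hB : Mbv ↔ Mvb
      swap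
      · refine type2_half hG (n + 1) (T - 1) hTT b v hbb2 hy hbv2 Mbv ?_ ?_
        · intro i j hij hj; exact hbv' i j hij (by omega)
        · intro i j hij hj; rw [G.adj_comm, hvb i j hij (by omega)]; tauto
      by_cases hAU : U ↔ Mav
      swap
      · refine type2_match hG (n + 1) (T - 1) hTT a v haa2 hy hav2 Mav ?_ ?_ ?_
        · intro i j hij hj; exact hav i j hij (by omega)
        · intro i j hij hj; rw [G.adj_comm, hva i j hij (by omega)]; tauto
        · intro i hi; rw [hUa i (by omega)]; tauto
      by_cases hBU : ¬ U ↔ Mbv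
      swap
      · refine type2_match hG (n + 1) (T - 1) hTT b v hbb2 hy hbv2 Mbv ?_ ?_ ?_
        · intro i j hij hj; exact hbv' i j hij (by omega)
        · intro i j hij hj; rw [G.adj_comm, hvb i j hij (by omega)]; tauto
        · intro i hi; rw [hUb i (by omega)]; tauto
      refine type1R hG n (v 0) (fun i => a (i + 1)) (fun i => b (i + 1))
        (fun i hi => hab _ (by omega)) (fun i j hij hj => hba _ _ (by omega) (by omega))
        (fun i hi => hbv2 _ _ (by omega) (by omega)) ?_
      intro i hi
      rw [hva 0 (i + 1) (by omega) (by omega), hvb 0 (i + 1) (by omega) (by omega)]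
      tauto
    · -- all `v` are equal
      have hv : ∀ i, i < n → v i = v n := by
        intro i hi
        have e1 := hO3 i n hi (by omega)
        have e2 := hO4 i n hi (by omega)
        have e3 : ¬ v i < v n := by tauto
        have e4 : ¬ v n < v i := by tauto
        omega
      refine type1R hG n (v n) a b (fun i hi => hab i (by omega))
        (fun i j hij hj => hba i j hij (by omega)) (fun i hi => hbv2 _ _ (by omega) (by omega)) ?_
      intro i hi
      rw [← hv i hi]
      exact hd i (by omega)

lemma speed_zero {P : HerProp} {N : ℕ} {G : SimpleGraph (Fin N)} (hG : G ∈ P.mem N) :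
    genFib 2 0 ≤ speed P 0 := by
  have := speed_ge hG (m := 0) (ι := Unit) (fun _ i => i.elim0) (fun _ i => i.elim0)
    (by intro w w' _; rfl)
  simpa [gf_zero] using this

lemma few_RB (m : ℕ) : ∃ K, ∀ P : HerProp, speed P m < genFib 2 m →
    ∀ N, ∀ G ∈ P.mem N, ∀ S : Finset ℕ, (∀ i ∈ S, RB G i) → S.card < K := by
  rcases Nat.eq_zero_or_pos m with rfl | hm
  · refine ⟨0, fun P hP N G hG => ?_⟩
    exact absurd (speed_zero hG) (by omega)
  obtain ⟨R, hR⟩ := ramsey_pairs (Fin 10 → Prop) ((m + 1) * (m + 1) + 3)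
  refine ⟨2 * R + 1, fun P hP N G hG S hS => ?_⟩
  by_contra hcard
  obtain ⟨d, hd1, hd2⟩ := exists_enum S (2 * R + 1) (by omega)
  have hex : ∀ i, ∃ a b v : Fin N, i < R → ((a : ℕ) = d (2 * i) ∧ (b : ℕ) = d (2 * i) + 1 ∧ b < v ∧
      ¬ (G.Adj v a ↔ G.Adj v b)) := by
    intro i
    by_cases hi : i < R
    · obtain ⟨a, b, v, h⟩ := hS _ (hd1 (2 * i) (by omega))
      exact ⟨a, b, v, fun _ => h⟩
    · obtain ⟨a, b, v, h⟩ := hS _ (hd1 0 (by omega))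
      exact ⟨a, b, v, fun h => absurd h hi⟩
  choose a b v h using hex
  obtain ⟨s, hs1, hs2, c, hc⟩ := hR (fun i j => ![v i < a j, v i < v j, v j < v i,
    G.Adj (a i) (a j), G.Adj (a i) (v j), G.Adj (v i) (a j), G.Adj (b i) (b j), G.Adj (b i) (v j),
    G.Adj (v i) (b j), G.Adj (a i) (v i)])
  have := homog_case hG m ((m + 1) * (m + 1) + 3) hm le_rfl (fun i => a (s i)) (fun i => b (s i))
    (fun i => v (s i)) ?_ ?_ ?_ ?_ (c 0) (c 1) (c 2) (c 3) (c 4) (c 5) (c 6) (c 7) (c 8) (c 9)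
    (fun i j hij hj => iff_of_eq (congrFun (hc i j hij hj) 0))
    (fun i j hij hj => iff_of_eq (congrFun (hc i j hij hj) 1))
    (fun i j hij hj => iff_of_eq (congrFun (hc i j hij hj) 2))
    (fun i j hij hj => iff_of_eq (congrFun (hc i j hij hj) 3))
    (fun i j hij hj => iff_of_eq (congrFun (hc i j hij hj) 4))
    (fun i j hij hj => iff_of_eq (congrFun (hc i j hij hj) 5))
    (fun i j hij hj => iff_of_eq (congrFun (hc i j hij hj) 6))
    (fun i j hij hj => iff_of_eq (congrFun (hc i j hij hj) 7))
    (fun i j hij hj => iff_of_eq (congrFun (hc i j hij hj) 8))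
    (fun i j hij hj => iff_of_eq (congrFun (hc i j hij hj) 9))
  · omega
  · intro i hi
    have := h (s i) (hs1 i hi)
    show a (s i) < b (s i)
    omega
  · intro i hi
    exact (h (s i) (hs1 i hi)).2.2.1
  · intro i j hij hj
    have e1 := h (s i) (hs1 i (by omega))
    have e2 := h (s j) (hs1 j hj)
    have e3 := hs2 i j hij hj
    have e4 := hs1 j hj
    have e5 := hd2 (2 * s i) (2 * s i + 1) (by omega) (by omega)
    have e6 := hd2 (2 * s i + 1) (2 * s j) (by omega) (by omega)
    show b (s i) < a (s j)
    omega
  · intro i hi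
    exact (h (s i) (hs1 i hi)).2.2.2

/-! ## Reversal -/

def HerProp.rev (P : HerProp) : HerProp where
  mem n := {G | G.comap Fin.rev ∈ P.mem n}
  hered := by
    rintro m n G H ⟨φ, hφ⟩ hH
    refine P.hered _ _ ⟨OrderEmbedding.ofStrictMono (fun i => (φ i.rev).rev) ?_, ?_⟩ hH
    · intro i j hij
      simpa using hij
    · intro i j
      show G.Adj i.rev j.rev ↔ H.Adj (φ i.rev).rev.rev (φ j.rev).rev.rev
      rw [Fin.rev_rev, Fin.rev_rev, hφ]

lemma speed_rev (P : HerProp) (n : ℕ) : speed P.rev n ≤ speed P n := by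
  refine Set.ncard_le_ncard_of_injOn (fun G : SimpleGraph (Fin n) => G.comap Fin.rev)
    (fun G hG => hG) ?_ (Set.toFinite _)
  intro G _ H _ h
  ext i j
  have := congrArg (fun K : SimpleGraph (Fin n) => K.Adj i.rev j.rev) h
  simpa using this

lemma LB_rev {N : ℕ} {G : SimpleGraph (Fin N)} {i : ℕ} (h : LB G i) :
    RB (G.comap Fin.rev) (N - 2 - i) := by
  obtain ⟨a, b, v, h1, h2, h3, h4⟩ := h
  refine ⟨b.rev, a.rev, v.rev, ?_, ?_, ?_, ?_⟩
  · rw [Fin.val_rev]; omega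
  · rw [Fin.val_rev]; omega
  · simpa using h3
  · simp; tauto

lemma few_breaks (m : ℕ) : ∃ K, ∀ P : HerProp, speed P m < genFib 2 m →
    ∀ N, ∀ G ∈ P.mem N, ∀ S : Finset ℕ, (∀ i ∈ S, RB G i ∨ LB G i) → S.card < K := by
  classical
  obtain ⟨K, hK⟩ := few_RB m
  refine ⟨2 * K, fun P hP N G hG S hS => ?_⟩
  have h1 := hK P hP N G hG (S.filter (fun i => RB G i)) (by simp)
  have hG' : G.comap Fin.rev ∈ P.rev.mem N := by
    show (G.comap Fin.rev).comap Fin.rev ∈ P.mem N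
    have : (G.comap Fin.rev).comap Fin.rev = G := by ext i j; simp
    rwa [this]
  have h2 := hK P.rev (lt_of_le_of_lt (speed_rev P m) hP) N _ hG'
    ((S.filter (fun i => ¬ RB G i)).image (fun i => N - 2 - i)) ?_
  · rw [Finset.card_image_of_injOn] at h2
    · have := Finset.card_filter_add_card_filter_not (s := S) (fun i => RB G i)
      omega
    · intro i hi j hj hij
      simp only [Finset.coe_filter, Set.mem_ofPred_eq] at hi hj
      have e1 := (hS i hi.1).resolve_left hi.2
      have e2 := (hS j hj.1).resolve_left hj.2
      obtain ⟨a, b, v, q1, q2, q3, -⟩ := e1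
      obtain ⟨a', b', v', q1', q2', q3', -⟩ := e2
      simp only at hij
      omega
  · intro i hi
    simp only [Finset.mem_image, Finset.mem_filter] at hi
    obtain ⟨j, ⟨hj1, hj2⟩, rfl⟩ := hi
    exact LB_rev ((hS j hj1).resolve_left hj2)

/-! ## Eventually polynomial functions -/

/-- The `d`-th forward difference of `f` eventually vanishes. -/
def Dz : ℕ → (ℕ → ℤ) → Prop
  | 0, f => ∃ N, ∀ n, N ≤ n → f n = 0
  | d + 1, f => Dz d (fun n => f (n + 1) - f n)

lemma Dz_congr (d : ℕ) : ∀ f g : ℕ → ℤ, (∃ N, ∀ n, N ≤ n → f n = g n) → Dz d f → Dz d g := by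
  induction d with
  | zero =>
    rintro f g ⟨N, hN⟩ ⟨M, hM⟩
    exact ⟨max N M, fun n hn => by
      rw [← hN n (le_trans (le_max_left _ _) hn), hM n (le_trans (le_max_right _ _) hn)]⟩
  | succ d ih =>
    rintro f g ⟨N, hN⟩ h
    refine ih _ _ ⟨N, fun n hn => ?_⟩ h
    rw [hN n hn, hN (n + 1) (by omega)]

lemma Dz_succ (d : ℕ) : ∀ f : ℕ → ℤ, Dz d f → Dz (d + 1) f := by
  induction d with
  | zero =>
    rintro f ⟨N, hN⟩
    exact ⟨N, fun n hn => by simp [hN n hn, hN (n + 1) (by omega)]⟩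
  | succ d ih => intro f h; exact ih _ h

lemma Dz_le {d e : ℕ} (h : d ≤ e) {f : ℕ → ℤ} (hf : Dz d f) : Dz e f := by
  induction h with
  | refl => exact hf
  | step _ ih => exact Dz_succ _ _ ih

lemma Dz_add' (d : ℕ) : ∀ f g : ℕ → ℤ, Dz d f → Dz d g → Dz d (fun n => f n + g n) := by
  induction d with
  | zero =>
    rintro f g ⟨N, hN⟩ ⟨M, hM⟩
    exact ⟨max N M, fun n hn => by
      simp [hN n (le_trans (le_max_left _ _) hn), hM n (le_trans (le_max_right _ _) hn)]⟩
  | succ d ih =>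
    intro f g hf hg
    refine Dz_congr d _ _ ⟨0, fun n _ => ?_⟩ (ih _ _ hf hg)
    simp only; ring

lemma Dz_shift (d j : ℕ) : ∀ f : ℕ → ℤ, Dz d f → Dz d (fun n => f (n - j)) := by
  induction d with
  | zero =>
    rintro f ⟨N, hN⟩
    exact ⟨N + j, fun n hn => hN _ (by omega)⟩
  | succ d ih =>
    intro f hf
    refine Dz_congr d _ _ ⟨j, fun n hn => ?_⟩ (ih _ hf)
    simp only
    rw [show n + 1 - j = n - j + 1 by omega]

lemma Dz_poly (d : ℕ) : ∀ f : ℕ → ℤ, Dz d f → ∃ (N : ℕ) (a : ℕ → ℤ), ∀ n : ℕ, N ≤ n →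
      f n = ∑ i ∈ Finset.range d, a i * (n.choose i : ℤ) := by
  induction d with
  | zero =>
    rintro f ⟨N, hN⟩
    exact ⟨N, fun _ => 0, by simpa using hN⟩
  | succ d ih =>
    intro f hf
    obtain ⟨N, a, ha⟩ := ih _ hf
    refine ⟨N, fun i => if i = 0 then f N - ∑ i ∈ Finset.range d, a i * (N.choose (i + 1) : ℤ)
      else a (i - 1), ?_⟩
    intro n hn
    rw [Finset.sum_range_succ']
    simp only [Nat.add_sub_cancel, Nat.choose_zero_right, if_true, Nat.add_eq_zero_iff, one_ne_zero,
      and_false, if_false]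
    induction n, hn using Nat.le_induction with
    | base => push_cast; ring
    | succ n hn ih2 =>
      have h1 := ha n hn
      have h2 : f (n + 1) = f n + ∑ i ∈ Finset.range d, a i * (n.choose i : ℤ) := by
        rw [← h1]; ring
      rw [h2, ih2]
      have h3 : ∑ i ∈ Finset.range d, a i * ((n + 1).choose (i + 1) : ℤ) =
          ∑ i ∈ Finset.range d, a i * (n.choose (i + 1) : ℤ) +
          ∑ i ∈ Finset.range d, a i * (n.choose i : ℤ) := by
        rw [← Finset.sum_add_distrib]
        apply Finset.sum_congr rfl
        intro i _
        rw [Nat.choose_succ_succ]; push_cast; ring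
      rw [h3]; ring

/-- Eventually polynomial. -/
def EP (f : ℕ → ℤ) : Prop := ∃ d, Dz d f

lemma EP_congr {f g : ℕ → ℤ} (N : ℕ) (h : ∀ n, N ≤ n → f n = g n) (hf : EP f) : EP g := by
  obtain ⟨d, hd⟩ := hf
  exact ⟨d, Dz_congr d f g ⟨N, h⟩ hd⟩

lemma EP_zero : EP (fun _ => 0) := ⟨0, 0, fun _ _ => rfl⟩

lemma EP_add {f g : ℕ → ℤ} (hf : EP f) (hg : EP g) : EP (fun n => f n + g n) := by
  obtain ⟨d, hd⟩ := hf
  obtain ⟨e, he⟩ := hg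
  exact ⟨max d e, Dz_add' _ _ _ (Dz_le (le_max_left _ _) hd) (Dz_le (le_max_right _ _) he)⟩

lemma EP_sum {ι : Type*} (s : Finset ι) (f : ι → ℕ → ℤ) (hf : ∀ i ∈ s, EP (f i)) :
    EP (fun n => ∑ i ∈ s, f i n) := by
  classical
  induction s using Finset.induction_on with
  | empty => simpa using EP_zero
  | insert a s ha ih =>
    simp only [Finset.sum_insert ha]
    exact EP_add (hf a (by simp)) (ih fun i hi => hf i (by simp [hi]))

lemma EP_shift {f : ℕ → ℤ} (j : ℕ) (hf : EP f) : EP (fun n => f (n - j)) := by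
  obtain ⟨d, hd⟩ := hf
  exact ⟨d, Dz_shift d j f hd⟩

lemma Dz_shift_add (d j : ℕ) : ∀ f : ℕ → ℤ, Dz d f → Dz d (fun n => f (n + j)) := by
  induction d with
  | zero =>
    rintro f ⟨N, hN⟩
    exact ⟨N, fun n hn => hN _ (by omega)⟩
  | succ d ih =>
    intro f hf
    refine Dz_congr d _ _ ⟨0, fun n hn => ?_⟩ (ih _ hf)
    simp only
    rw [show n + 1 + j = n + j + 1 by omega]

lemma EP_diff {f g : ℕ → ℤ} (h : ∀ n, f (n + 1) = g (n + 1) + f n) (hg : EP g) : EP f := by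
  obtain ⟨d, hd⟩ := hg
  refine ⟨d + 1, Dz_congr d _ _ ⟨0, fun n _ => ?_⟩ (Dz_shift_add d 1 g hd)⟩
  rw [h]; ring

/-! ## Counting points of lower sets in `ℕ^k` -/

instance lowerSet_wf (k : ℕ) : WellFoundedLT (LowerSet (Fin k → ℕ)) := by
  refine ⟨?_⟩
  rw [RelEmbedding.wellFounded_iff_isEmpty]
  refine ⟨fun e => ?_⟩
  have hstep : ∀ n, ∃ t, t ∈ e n ∧ t ∉ e (n + 1) := by
    intro n
    have : e (n + 1) < e n := e.map_rel_iff.2 (Nat.lt_succ_self n)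
    have h2 : ¬ (e n ≤ e (n + 1)) := not_le_of_gt this
    have h3 : ¬ ((e n : Set (Fin k → ℕ)) ⊆ (e (n + 1) : Set (Fin k → ℕ))) := h2
    rw [Set.not_subset] at h3
    obtain ⟨t, h4, h5⟩ := h3
    exact ⟨t, h4, h5⟩
  choose t ht1 ht2 using hstep
  have hanti : ∀ i j, i ≤ j → e j ≤ e i := by
    intro i j hij
    induction hij with
    | refl => exact le_rfl
    | step _ ih => exact le_trans (le_of_lt (e.map_rel_iff.2 (Nat.lt_succ_self _))) ih
  obtain ⟨m, n, hmn, hle⟩ := (wellQuasiOrdered_le (α := Fin k → ℕ)) t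
  exact ht2 m ((e (m + 1)).lower hle (hanti (m + 1) n hmn (ht1 n)))

noncomputable def cnt {k : ℕ} (D : LowerSet (Fin k → ℕ)) (n : ℕ) : ℕ :=
  {t : Fin k → ℕ | t ∈ D ∧ ∑ i, t i = n}.ncard

lemma finite_sum_eq {k : ℕ} (n : ℕ) : {t : Fin k → ℕ | ∑ i, t i = n}.Finite := by
  refine (Set.finite_Icc (0 : Fin k → ℕ) (fun _ => n)).subset ?_
  intro t ht
  refine ⟨fun i => Nat.zero_le _, fun i => ?_⟩
  have : ∑ i, t i = n := ht
  rw [← this]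
  exact Finset.single_le_sum (f := t) (fun _ _ => Nat.zero_le _) (Finset.mem_univ i)

def slice0 {k : ℕ} (D : LowerSet (Fin (k + 1) → ℕ)) : LowerSet (Fin k → ℕ) where
  carrier := {t | (Fin.cons 0 t : Fin (k + 1) → ℕ) ∈ D}
  lower' := by
    intro s t hts hs
    refine D.lower ?_ hs
    intro i
    induction i using Fin.cases with
    | zero => simp
    | succ i => simpa using hts i

/-- Increase the first coordinate. -/
def up {k : ℕ} (t : Fin (k + 1) → ℕ) : Fin (k + 1) → ℕ := Fin.cons (t 0 + 1) (Fin.tail t)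

lemma le_up {k : ℕ} (t : Fin (k + 1) → ℕ) : t ≤ up t := by
  intro i
  induction i using Fin.cases with
  | zero => simp [up]
  | succ i => simp [up, Fin.tail]

lemma up_mono {k : ℕ} {s t : Fin (k + 1) → ℕ} (h : s ≤ t) : up s ≤ up t := by
  intro i
  induction i using Fin.cases with
  | zero => simpa [up] using h 0
  | succ i => simpa [up, Fin.tail] using h i.succ

def shiftD {k : ℕ} (D : LowerSet (Fin (k + 1) → ℕ)) : LowerSet (Fin (k + 1) → ℕ) where
  carrier := {t | up t ∈ D}
  lower' := fun _ _ hts hs => D.lower (up_mono hts) hs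

lemma shiftD_le {k : ℕ} (D : LowerSet (Fin (k + 1) → ℕ)) : shiftD D ≤ D :=
  fun _ ht => D.lower (le_up _) ht

lemma cnt_rec {k : ℕ} (D : LowerSet (Fin (k + 1) → ℕ)) (n : ℕ) :
    cnt D (n + 1) = cnt (slice0 D) (n + 1) + cnt (shiftD D) n := by
  unfold cnt
  have e : {t : Fin (k + 1) → ℕ | t ∈ D ∧ ∑ i, t i = n + 1} =
      (fun t => (Fin.cons 0 t : Fin (k + 1) → ℕ)) '' {t | t ∈ slice0 D ∧ ∑ i, t i = n + 1} ∪
      up '' {t | t ∈ shiftD D ∧ ∑ i, t i = n} := by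
    ext t
    constructor
    · rintro ⟨h1, h2⟩
      rw [Fin.sum_univ_succ] at h2
      rcases Nat.eq_zero_or_pos (t 0) with h0 | h0
      · left
        have e : (Fin.cons 0 (Fin.tail t) : Fin (k + 1) → ℕ) = t := by
          rw [← h0]; exact Fin.cons_self_tail t
        refine ⟨Fin.tail t, ⟨?_, ?_⟩, e⟩
        · show (Fin.cons 0 (Fin.tail t) : Fin (k + 1) → ℕ) ∈ D
          rwa [e]
        · simp only [Fin.tail]; omega
      · right
        have e : up (Fin.cons (t 0 - 1) (Fin.tail t) : Fin (k + 1) → ℕ) = t := by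
          simp only [up, Fin.cons_zero, Fin.tail_cons]
          rw [Nat.sub_add_cancel h0]; exact Fin.cons_self_tail t
        refine ⟨(Fin.cons (t 0 - 1) (Fin.tail t) : Fin (k + 1) → ℕ), ⟨?_, ?_⟩, e⟩
        · show up _ ∈ D
          rwa [e]
        · rw [Fin.sum_univ_succ]
          simp only [Fin.cons_zero, Fin.cons_succ, Fin.tail]
          omega
    · rintro (⟨s, ⟨h1, h2⟩, rfl⟩ | ⟨s, ⟨h1, h2⟩, rfl⟩)
      · refine ⟨h1, ?_⟩
        rw [Fin.sum_univ_succ]; simpa using h2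
      · refine ⟨h1, ?_⟩
        rw [Fin.sum_univ_succ] at h2 ⊢
        simp only [up, Fin.cons_zero, Fin.cons_succ, Fin.tail]
        omega
  have hf1 := ((finite_sum_eq (n + 1)).subset (fun t (h : t ∈ {t | t ∈ slice0 D ∧ ∑ i, t i = n + 1}) => h.2)).image
    (fun t => (Fin.cons 0 t : Fin (k + 1) → ℕ))
  have hf2 := ((finite_sum_eq n).subset (fun t (h : t ∈ {t | t ∈ shiftD D ∧ ∑ i, t i = n}) => h.2)).image up
  rw [e, Set.ncard_union_eq ?_ hf1 hf2]
  · rw [Set.ncard_image_of_injective, Set.ncard_image_of_injective]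
    · intro s t hst
      have h0 := congrFun hst 0
      have h1 : Fin.tail s = Fin.tail t := by
        have := congrArg Fin.tail hst
        simpa [up] using this
      simp only [up, Fin.cons_zero] at h0
      rw [← Fin.cons_self_tail s, ← Fin.cons_self_tail t, h1, show s 0 = t 0 by omega]
    · intro s t hst
      have := congrArg Fin.tail hst
      simpa using this
  · rw [Set.disjoint_left]
    rintro _ ⟨s, -, rfl⟩ ⟨t, -, h⟩
    have h0 := congrFun h 0
    simp [up] at h0

lemma cnt_EP (k : ℕ) : ∀ D : LowerSet (Fin k → ℕ), EP (fun n => (cnt D n : ℤ)) := by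
  induction k with
  | zero =>
    intro D
    refine ⟨0, 1, fun n hn => ?_⟩
    have : {t : Fin 0 → ℕ | t ∈ D ∧ ∑ i, t i = n} = ∅ := by
      ext t
      simp only [Finset.univ_eq_empty, Finset.sum_empty, Set.mem_ofPred_eq, Set.mem_empty_iff_false,
        iff_false, not_and]
      intro _; omega
    show ((cnt D n : ℕ) : ℤ) = 0
    unfold cnt
    rw [this]; simp
  | succ k ih =>
    intro D
    induction D using WellFoundedLT.induction with
    | ind D ihD =>
    by_cases h : shiftD D = D
    · refine EP_diff (g := fun n => (cnt (slice0 D) n : ℤ)) (fun n => ?_) (ih _)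
      have := cnt_rec D n
      rw [h] at this
      rw [this]; push_cast; ring
    · have h2 := ihD _ (lt_of_le_of_ne (shiftD_le D) h)
      refine EP_congr 1 (fun n hn => ?_) (EP_add (ih (slice0 D)) (EP_shift 1 h2))
      obtain ⟨n, rfl⟩ : ∃ r, n = r + 1 := ⟨n - 1, by omega⟩
      have := cnt_rec D n
      simp only [Nat.add_sub_cancel]
      rw [this]; push_cast; ring

/-! ## Canonical presentations -/

/-- Position `j` is a break. -/
def brk {n : ℕ} (G : SimpleGraph (Fin n)) (j : ℕ) : Prop := RB G j ∨ LB G j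

open Classical in
/-- Number of breaks before `i`, i.e. the index of the block containing `i`. -/
noncomputable def bl {n : ℕ} (G : SimpleGraph (Fin n)) (i : ℕ) : ℕ :=
  ((Finset.range i).filter (fun j => brk G j)).card

lemma bl_zero {n : ℕ} (G : SimpleGraph (Fin n)) : bl G 0 = 0 := by simp [bl]

lemma bl_succ_of {n : ℕ} {G : SimpleGraph (Fin n)} {i : ℕ} (h : brk G i) :
    bl G (i + 1) = bl G i + 1 := by
  classical
  unfold bl
  rw [Finset.range_add_one, Finset.filter_insert, if_pos h, Finset.card_insert_of_notMem]
  simp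

lemma bl_succ_of_not {n : ℕ} {G : SimpleGraph (Fin n)} {i : ℕ} (h : ¬ brk G i) :
    bl G (i + 1) = bl G i := by
  classical
  unfold bl
  rw [Finset.range_add_one, Finset.filter_insert, if_neg h]

lemma bl_mono {n : ℕ} (G : SimpleGraph (Fin n)) : Monotone (bl G) := by
  refine monotone_nat_of_le_succ (fun i => ?_)
  by_cases h : brk G i
  · rw [bl_succ_of h]; omega
  · rw [bl_succ_of_not h]

/-- twins -/
def tw {n : ℕ} (G : SimpleGraph (Fin n)) (a b : Fin n) : Prop :=
  ∀ v, v ≠ a → v ≠ b → (G.Adj v a ↔ G.Adj v b)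

lemma tw_symm {n : ℕ} {G : SimpleGraph (Fin n)} {a b : Fin n} (h : tw G a b) : tw G b a :=
  fun v h1 h2 => (h v h2 h1).symm

lemma tw_trans {n : ℕ} {G : SimpleGraph (Fin n)} {a b c : Fin n} (h : tw G a b) (h' : tw G b c) :
    tw G a c := by
  intro v hva hvc
  by_cases hvb : v = b
  · subst hvb
    by_cases hac : a = c
    · rw [hac]
    · have h1 := h' a (Ne.symm hva) hac
      have h2 := h c (Ne.symm hac) (Ne.symm hvc)
      rw [G.adj_comm v a, h1, G.adj_comm a c, h2, G.adj_comm]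
  · exact (h v hva hvb).trans (h' v hvb hvc)

lemma not_brk_tw {n : ℕ} {G : SimpleGraph (Fin n)} {i : ℕ} (h : ¬ brk G i) (hi : i + 1 < n) :
    tw G ⟨i, by omega⟩ ⟨i + 1, hi⟩ := by
  intro v h1 h2
  by_contra hc
  apply h
  have h1' : (v : ℕ) ≠ i := fun e => h1 (Fin.ext e)
  have h2' : (v : ℕ) ≠ i + 1 := fun e => h2 (Fin.ext e)
  rcases lt_or_gt_of_ne h1' with h3 | h3
  · exact Or.inr ⟨⟨i, by omega⟩, ⟨i + 1, hi⟩, v, rfl, rfl, h3, hc⟩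
  · refine Or.inl ⟨⟨i, by omega⟩, ⟨i + 1, hi⟩, v, rfl, rfl, ?_, hc⟩
    show i + 1 < (v : ℕ)
    omega

lemma tw_of_bl_eq {n : ℕ} {G : SimpleGraph (Fin n)} (d : ℕ) : ∀ i : ℕ, ∀ hd : i + d < n,
    bl G i = bl G (i + d) → tw G ⟨i, by omega⟩ ⟨i + d, hd⟩ := by
  induction d with
  | zero => intro i hd _ v _ _; exact Iff.rfl
  | succ d ih =>
    intro i hd h
    have h1 := bl_mono G (show i ≤ i + d by omega)
    have h2 := bl_mono G (show i + d ≤ i + (d + 1) by omega)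
    refine tw_trans (ih i (by omega) (by omega)) ?_
    have : ¬ brk G (i + d) := by
      intro hb
      have := bl_succ_of hb
      rw [show i + d + 1 = i + (d + 1) by omega] at this
      omega
    exact not_brk_tw this (by omega)

lemma tw_of_bl {n : ℕ} {G : SimpleGraph (Fin n)} {a b : Fin n} (h : bl G a = bl G b) :
    tw G a b := by
  rcases le_total a b with hab | hab
  · have hab' : (a : ℕ) ≤ b := hab
    have e : (a : ℕ) + (b - a) = b := by omega
    have := tw_of_bl_eq (G := G) (b - a) a (by omega) (by rw [e]; exact h)
    simp only [e] at this
    exact this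
  · have hab' : (b : ℕ) ≤ a := hab
    have e : (b : ℕ) + (a - b) = a := by omega
    have := tw_of_bl_eq (G := G) (a - b) b (by omega) (by rw [e]; exact h.symm)
    simp only [e] at this
    exact tw_symm this

lemma adj_welldef {n : ℕ} {G : SimpleGraph (Fin n)} {i j i' j' : Fin n} (hi : bl G i = bl G i')
    (hj : bl G j = bl G j') (hij : i ≠ j) (h : G.Adj i' j') : G.Adj i j := by
  have hij' := h.ne
  have ti := tw_of_bl hi
  have tj := tw_of_bl hj
  by_cases h1 : i' = j
  · by_cases h2 : j' = i
    · subst h1 h2; exact h.symm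
    · have h3 : G.Adj j' i := (ti j' h2 (Ne.symm hij')).2 h.symm
      exact (tj i hij (Ne.symm h2)).2 h3.symm
  · have h3 : G.Adj i' j := (tj i' h1 hij').2 h
    exact ((ti j (Ne.symm hij) (Ne.symm h1)).2 h3.symm).symm

lemma bl_surj {n : ℕ} (G : SimpleGraph (Fin n)) (N q : ℕ) (h : q ≤ bl G N) :
    ∃ i ≤ N, bl G i = q ∧ (0 < q → ∃ j, i = j + 1 ∧ bl G j + 1 = q ∧ brk G j) := by
  induction N with
  | zero =>
    rw [bl_zero] at h
    exact ⟨0, le_rfl, by rw [bl_zero]; omega, fun h0 => by omega⟩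
  | succ N ih =>
    by_cases hq : q ≤ bl G N
    · obtain ⟨i, hi, h2⟩ := ih hq
      exact ⟨i, by omega, h2⟩
    · by_cases hb : brk G N
      · have := bl_succ_of hb
        exact ⟨N + 1, le_rfl, by omega, fun _ => ⟨N, rfl, by omega, hb⟩⟩
      · rw [bl_succ_of_not hb] at h; omega

/-- fiber sizes -/
def fib {n k : ℕ} (β : Fin n → Fin k) (q : Fin k) : ℕ := (univ.filter (fun i => β i = q)).card

structure Canon (k : ℕ) (H : Fin k → Fin k → Prop) (s : Fin k → Prop) : Prop where
  symm : ∀ p q, H p q → H q p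
  diag : ∀ p, H p p → s p
  dist : ∀ p p' : Fin k, (p' : ℕ) = p + 1 → ∃ q, ¬ (H p q ↔ H p' q) ∧ (q = p ∨ q = p' → s q)

structure Pres {n k : ℕ} (H : Fin k → Fin k → Prop) (s : Fin k → Prop) (G : SimpleGraph (Fin n))
    (β : Fin n → Fin k) : Prop where
  mono : Monotone β
  adj : ∀ i j, G.Adj i j ↔ i ≠ j ∧ H (β i) (β j)
  pos : ∀ q, 1 ≤ fib β q
  size : ∀ q, s q ↔ 2 ≤ fib β q

lemma two_le_fib {n k : ℕ} {β : Fin n → Fin k} {i j : Fin n} (hij : i ≠ j) (h : β i = β j) :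
    2 ≤ fib β (β i) := by
  have : ({i, j} : Finset (Fin n)) ⊆ univ.filter (fun a => β a = β i) := by
    intro a ha
    simp only [mem_insert, mem_singleton] at ha
    rcases ha with rfl | rfl
    · simp
    · simp [h]
  have h2 := Finset.card_le_card this
  rw [Finset.card_pair hij] at h2
  exact h2

lemma exists_of_fib {n k : ℕ} {β : Fin n → Fin k} {q : Fin k} (h : 1 ≤ fib β q) :
    ∃ i, β i = q := by
  obtain ⟨i, hi⟩ := Finset.card_pos.1 (show 0 < (univ.filter (fun i => β i = q)).card from h)
  exact ⟨i, by simpa using hi⟩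

lemma exists_ne_of_fib {n k : ℕ} {β : Fin n → Fin k} {q : Fin k} (h : 2 ≤ fib β q) (a : Fin n) :
    ∃ i, i ≠ a ∧ β i = q := by
  obtain ⟨i, hi, hia⟩ := Finset.exists_mem_ne (s := univ.filter (fun i => β i = q)) (by
    unfold fib at h; omega) a
  exact ⟨i, hia, by simpa using hi⟩

lemma exists_pres {n : ℕ} (hn : 0 < n) (G : SimpleGraph (Fin n)) :
    ∃ H s β, Canon (bl G (n - 1) + 1) H s ∧ Pres H s G β := by
  classical
  set k := bl G (n - 1) + 1 with hk
  let β : Fin n → Fin k := fun i => ⟨bl G i, by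
    have := bl_mono G (show (i : ℕ) ≤ n - 1 by omega)
    omega⟩
  have hβ : ∀ i i', β i = β i' ↔ bl G i = bl G i' := fun i i' => by simp [β]
  let H : Fin k → Fin k → Prop := fun p q => ∃ i j, β i = p ∧ β j = q ∧ G.Adj i j
  let s : Fin k → Prop := fun q => 2 ≤ fib β q
  have hH : ∀ i j, i ≠ j → (H (β i) (β j) ↔ G.Adj i j) := by
    intro i j hij
    constructor
    · rintro ⟨i', j', h1, h2, h3⟩
      exact adj_welldef ((hβ _ _).1 h1.symm) ((hβ _ _).1 h2.symm) hij h3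
    · intro h; exact ⟨i, j, rfl, rfl, h⟩
  have hsurj : ∀ q : Fin k, ∃ i, β i = q := by
    intro q
    obtain ⟨i, hi, h1, -⟩ := bl_surj G (n - 1) q (by omega)
    exact ⟨⟨i, by omega⟩, Fin.ext h1⟩
  refine ⟨H, s, β, ⟨?_, ?_, ?_⟩, ⟨?_, ?_, ?_, ?_⟩⟩
  · rintro p q ⟨i, j, h1, h2, h3⟩
    exact ⟨j, i, h2, h1, h3.symm⟩
  · rintro p ⟨i, j, h1, h2, h3⟩
    have := two_le_fib (β := β) h3.ne (h1.trans h2.symm)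
    rw [h1] at this
    exact this
  · intro p p' hp
    obtain ⟨i, hi, h1, h2⟩ := bl_surj G (n - 1) p' (by omega)
    obtain ⟨j, rfl, hj, hb⟩ := h2 (by omega)
    have main : ∀ a b v : Fin n, (a : ℕ) = j → (b : ℕ) = j + 1 → v ≠ a → v ≠ b →
        ¬ (G.Adj v a ↔ G.Adj v b) →
        ∃ q, ¬ (H p q ↔ H p' q) ∧ (q = p ∨ q = p' → s q) := by
      intro a b v ha hb hva hvb hn
      have ep : β a = p := Fin.ext (by show bl G a = p; rw [ha]; omega)
      have ep' : β b = p' := Fin.ext (by show bl G b = p'; rw [hb]; omega)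
      refine ⟨β v, ?_, ?_⟩
      · rw [← ep, ← ep', hH _ _ (Ne.symm hva), hH _ _ (Ne.symm hvb), G.adj_comm a, G.adj_comm b]
        exact hn
      · rintro (h | h)
        · exact two_le_fib hva (h.trans ep.symm)
        · exact two_le_fib hvb (h.trans ep'.symm)
    rcases hb with ⟨a, b, v, ha, hb, hv, hn⟩ | ⟨a, b, v, ha, hb, hv, hn⟩
    · exact main a b v ha hb (by rintro rfl; have : (b : ℕ) < v := hv; omega)
        (by rintro rfl; exact lt_irrefl _ hv) hn
    · exact main a b v ha hb (by rintro rfl; exact lt_irrefl _ hv)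
        (by rintro rfl; have : (v : ℕ) < a := hv; omega) hn
  · intro i j hij
    exact bl_mono G hij
  · intro i j
    constructor
    · intro h; exact ⟨h.ne, (hH _ _ h.ne).2 h⟩
    · rintro ⟨h1, h2⟩; exact (hH _ _ h1).1 h2
  · intro q
    obtain ⟨i, hi⟩ := hsurj q
    exact Finset.card_pos.2 ⟨i, by simp [hi]⟩
  · intro q; exact Iff.rfl

lemma pres_bl {n k : ℕ} {H : Fin k → Fin k → Prop} {s : Fin k → Prop} {G : SimpleGraph (Fin n)}
    {β : Fin n → Fin k} (hc : Canon k H s) (h : Pres H s G β) (i : ℕ) :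
    ∀ hi : i < n, ((β ⟨i, hi⟩ : Fin k) : ℕ) = bl G i := by
  induction i with
  | zero =>
    intro hi
    rw [bl_zero]
    obtain ⟨j, hj⟩ := exists_of_fib (h.pos ⟨0, lt_of_le_of_lt (Nat.zero_le _) (β ⟨0, hi⟩).2⟩)
    have h1 : β ⟨0, hi⟩ ≤ β j := h.mono (Fin.mk_le_of_le_val (Nat.zero_le _))
    rw [hj] at h1
    have h2 : ((β ⟨0, hi⟩ : Fin k) : ℕ) ≤ 0 := h1
    omega
  | succ i ih =>
    intro hi
    have ih := ih (by omega)
    set a : Fin n := ⟨i, by omega⟩ with ha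
    set b : Fin n := ⟨i + 1, hi⟩ with hb
    have hab : β a ≤ β b := h.mono (by simp [ha, hb, Fin.le_def])
    have hstep : (β b : ℕ) ≤ β a + 1 := by
      by_contra hcon
      obtain ⟨j, hj⟩ := exists_of_fib (h.pos ⟨β a + 1, by omega⟩)
      have hj' : (β j : ℕ) = β a + 1 := by rw [hj]
      rcases Nat.lt_or_ge i j with hlt | hge
      · have : β b ≤ β j := h.mono (by rw [Fin.le_def]; exact hlt)
        rw [Fin.le_def] at this; omega
      · have : β j ≤ β a := h.mono (by rw [Fin.le_def]; exact hge)
        rw [Fin.le_def] at this; omega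
    by_cases he : β a = β b
    · have hnb : ¬ brk G i := by
        have key : ∀ a' b' v : Fin n, (a' : ℕ) = i → (b' : ℕ) = i + 1 → v ≠ a' → v ≠ b' →
            (G.Adj v a' ↔ G.Adj v b') := by
          intro a' b' v ha' hb' h1 h2
          obtain rfl : a' = a := Fin.ext ha'
          obtain rfl : b' = b := Fin.ext hb'
          rw [h.adj, h.adj, he]
          simp [h1, h2]
        rintro (⟨a', b', v, ha', hb', hv, hn⟩ | ⟨a', b', v, ha', hb', hv, hn⟩)
        · exact hn (key a' b' v ha' hb' (by rintro rfl; have : (b' : ℕ) < v := hv; omega)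
            (by rintro rfl; exact lt_irrefl _ hv))
        · exact hn (key a' b' v ha' hb' (by rintro rfl; exact lt_irrefl _ hv)
            (by rintro rfl; have : (v : ℕ) < a' := hv; omega))
      rw [bl_succ_of_not hnb, ← ih, he]
    · have he' : (β b : ℕ) = β a + 1 := by
        have h1 : (β a : ℕ) ≠ β b := fun e => he (Fin.ext e)
        rw [Fin.le_def] at hab
        omega
      have hbk : brk G i := by
        obtain ⟨q, hq1, hq2⟩ := hc.dist (β a) (β b) he'
        have hv : ∃ v, v ≠ a ∧ v ≠ b ∧ β v = q := by
          by_cases h1 : q = β a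
          · have hs := (h.size q).1 (hq2 (Or.inl h1))
            obtain ⟨v, hv1, hv2⟩ := exists_ne_of_fib hs a
            exact ⟨v, hv1, by rintro rfl; exact he (h1.symm.trans hv2.symm), hv2⟩
          · by_cases h2 : q = β b
            · have hs := (h.size q).1 (hq2 (Or.inr h2))
              obtain ⟨v, hv1, hv2⟩ := exists_ne_of_fib hs b
              exact ⟨v, by rintro rfl; exact h1 hv2.symm, hv1, hv2⟩
            · obtain ⟨v, hv⟩ := exists_of_fib (h.pos q)
              exact ⟨v, by rintro rfl; exact h1 hv.symm, by rintro rfl; exact h2 hv.symm, hv⟩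
        obtain ⟨v, hva, hvb, hvq⟩ := hv
        by_contra hnb
        have := not_brk_tw hnb hi v hva hvb
        rw [h.adj, h.adj] at this
        have h3 : H (β v) (β a) ↔ H (β v) (β b) := by
          simpa [← ha, ← hb, hva, hvb] using this
        rw [hvq] at h3
        exact hq1 ⟨fun x => hc.symm _ _ (h3.1 (hc.symm _ _ x)),
          fun x => hc.symm _ _ (h3.2 (hc.symm _ _ x))⟩
      rw [bl_succ_of hbk, ← ih, he']

lemma pres_bl' {n k : ℕ} {H : Fin k → Fin k → Prop} {s : Fin k → Prop} {G : SimpleGraph (Fin n)}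
    {β : Fin n → Fin k} (hc : Canon k H s) (h : Pres H s G β) (i : Fin n) :
    (β i : ℕ) = bl G i := pres_bl hc h i i.2

lemma pres_k_le {n k k' : ℕ} {H : Fin k → Fin k → Prop} {s : Fin k → Prop}
    {H' : Fin k' → Fin k' → Prop} {s' : Fin k' → Prop} {G : SimpleGraph (Fin n)}
    {β : Fin n → Fin k} {β' : Fin n → Fin k'} (hc : Canon k H s) (h : Pres H s G β)
    (hc' : Canon k' H' s') (h' : Pres H' s' G β') : k ≤ k' := by
  rcases Nat.eq_zero_or_pos k with h0 | h0
  · omega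
  · obtain ⟨i, hi⟩ := exists_of_fib (h.pos ⟨k - 1, by omega⟩)
    have h1 := pres_bl' hc h i
    have h2 := pres_bl' hc' h' i
    rw [hi] at h1
    have h3 := (β' i).2
    simp only at h1
    omega

lemma pres_unique {n k : ℕ} {H : Fin k → Fin k → Prop} {s : Fin k → Prop}
    {H' : Fin k → Fin k → Prop} {s' : Fin k → Prop} {G : SimpleGraph (Fin n)}
    {β β' : Fin n → Fin k} (hc : Canon k H s) (h : Pres H s G β)
    (hc' : Canon k H' s') (h' : Pres H' s' G β') : H = H' ∧ s = s' := by
  have hβ : β = β' := by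
    funext i
    exact Fin.ext ((pres_bl' hc h i).trans (pres_bl' hc' h' i).symm)
  subst hβ
  have hs : s = s' := by
    funext q
    exact propext ((h.size q).trans (h'.size q).symm)
  subst hs
  refine ⟨?_, rfl⟩
  funext p q
  apply propext
  have key : ∀ i j, i ≠ j → (H (β i) (β j) ↔ H' (β i) (β j)) := by
    intro i j hij
    have h1 := h.adj i j
    have h2 := h'.adj i j
    rw [h1] at h2
    simpa [hij] using h2
  obtain ⟨i, rfl⟩ := exists_of_fib (h.pos p)
  by_cases hpq : q = β i
  · subst hpq
    by_cases hs : s (β i)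
    · obtain ⟨j, hj, hj2⟩ := exists_ne_of_fib ((h.size _).1 hs) i
      have := key i j hj.symm
      rwa [hj2] at this
    · exact ⟨fun x => absurd (hc.diag _ x) hs, fun x => absurd (hc'.diag _ x) hs⟩
  · obtain ⟨j, rfl⟩ := exists_of_fib (h.pos q)
    exact key i j (by rintro rfl; exact hpq rfl)

/-! ## Monotone maps are determined by their fiber sizes -/

lemma mono_lt_iff {n k : ℕ} {β : Fin n → Fin k} (h : Monotone β) (i : Fin n) (q : Fin k) :
    β i < q ↔ (i : ℕ) < (univ.filter (fun j => β j < q)).card := by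
  constructor
  · intro hi
    have : Finset.Iic i ⊆ univ.filter (fun j => β j < q) := by
      intro j hj
      simp only [Finset.mem_Iic] at hj
      simp only [mem_filter, mem_univ, true_and]
      exact lt_of_le_of_lt (h hj) hi
    have := Finset.card_le_card this
    rw [Fin.card_Iic] at this
    omega
  · intro hi
    by_contra hc
    have : univ.filter (fun j => β j < q) ⊆ Finset.Iio i := by
      intro j hj
      simp only [mem_filter, mem_univ, true_and] at hj
      rw [Finset.mem_Iio]
      by_contra hc2
      exact hc (lt_of_le_of_lt (h (not_lt.1 hc2)) hj)
    have := Finset.card_le_card this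
    rw [Fin.card_Iio] at this
    omega

lemma card_lt_eq {n k : ℕ} (β : Fin n → Fin k) (q : Fin k) :
    (univ.filter (fun j => β j < q)).card = ∑ p ∈ Finset.Iio q, fib β p := by
  rw [Finset.card_eq_sum_card_fiberwise (f := β) (t := Finset.Iio q)]
  · apply Finset.sum_congr rfl
    intro p hp
    rw [Finset.mem_Iio] at hp
    unfold fib
    rw [Finset.filter_filter]
    congr 1
    ext j
    simp only [mem_filter, mem_univ, true_and]
    constructor
    · rintro ⟨_, h⟩; exact h
    · rintro rfl; exact ⟨hp, rfl⟩
  · intro j hj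
    simpa using hj

lemma mono_eq_of_fib {n k : ℕ} {β β' : Fin n → Fin k} (h : Monotone β) (h' : Monotone β')
    (hf : ∀ q, fib β q = fib β' q) : β = β' := by
  have key : ∀ i q, β i < q ↔ β' i < q := by
    intro i q
    rw [mono_lt_iff h, mono_lt_iff h', card_lt_eq, card_lt_eq]
    simp only [hf]
  funext i
  rcases lt_trichotomy (β i) (β' i) with h1 | h1 | h1
  · exact absurd ((key i _).1 h1) (lt_irrefl _)
  · exact h1
  · exact absurd ((key i _).2 h1) (lt_irrefl _)

lemma sum_fib {n k : ℕ} (β : Fin n → Fin k) : ∑ q, fib β q = n := by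
  have := Finset.card_eq_sum_card_fiberwise (f := β) (s := univ) (t := univ) (by intro x _; simp)
  rw [Finset.card_univ, Fintype.card_fin] at this
  exact this.symm

/-! ## The lower set attached to a canonical type -/

open Classical in
noncomputable def base {k : ℕ} (s : Fin k → Prop) : Fin k → ℕ := fun q => if s q then 2 else 1

lemma base_le {n k : ℕ} {H : Fin k → Fin k → Prop} {s : Fin k → Prop}
    {G : SimpleGraph (Fin n)} {β : Fin n → Fin k} (h : Pres H s G β) (q : Fin k) :
    base s q ≤ fib β q := by
  unfold base
  split_ifs with hs
  · exact (h.size q).1 hs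
  · exact h.pos q

lemma sub_pres {P : HerProp} {n k : ℕ} {H : Fin k → Fin k → Prop} {s : Fin k → Prop}
    {G : SimpleGraph (Fin n)} {β : Fin n → Fin k} (hG : G ∈ P.mem n) (h : Pres H s G β)
    (u : Fin k → ℕ) (hu1 : ∀ q, base s q ≤ u q) (hu2 : ∀ q, u q ≤ fib β q) :
    ∃ (n' : ℕ) (G' : SimpleGraph (Fin n')) (β' : Fin n' → Fin k),
      G' ∈ P.mem n' ∧ Pres H s G' β' ∧ ∀ q, fib β' q = u q := by
  classical
  have hA : ∀ q, ∃ A ⊆ univ.filter (fun i => β i = q), A.card = u q :=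
    fun q => Finset.exists_subset_card_eq (hu2 q)
  choose A hA1 hA2 using hA
  have hAβ : ∀ q, ∀ i ∈ A q, β i = q := fun q i hi => by simpa using hA1 q hi
  let S : Finset (Fin n) := univ.biUnion A
  let ψ : Fin S.card ↪o Fin n := S.orderEmbOfFin rfl
  have hψ : ∀ x, x ∈ S ↔ ∃ i, ψ i = x := by
    intro x
    have := Finset.range_orderEmbOfFin S rfl
    rw [← Finset.mem_coe, ← this]
    rfl
  have hfib : ∀ q, fib (fun i => β (ψ i)) q = u q := by
    intro q
    rw [← hA2 q]
    unfold fib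
    rw [← Finset.card_map ψ.toEmbedding]
    congr 1
    ext x
    simp only [mem_map, mem_filter, mem_univ, true_and]
    constructor
    · rintro ⟨i, hi, rfl⟩
      have : ψ i ∈ S := (hψ _).2 ⟨i, rfl⟩
      obtain ⟨q', -, hq'⟩ := Finset.mem_biUnion.1 this
      have h1 := hAβ q' _ hq'
      rw [hi] at h1
      subst h1
      exact hq'
    · intro hx
      obtain ⟨i, hi⟩ := (hψ x).1 (Finset.mem_biUnion.2 ⟨q, mem_univ _, hx⟩)
      exact ⟨i, by rw [hi]; exact hAβ q x hx, hi⟩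
  refine ⟨S.card, G.comap ψ, fun i => β (ψ i), ?_, ⟨?_, ?_, ?_, ?_⟩, hfib⟩
  · exact P.hered _ G ⟨ψ, fun i j => Iff.rfl⟩ hG
  · exact h.mono.comp ψ.monotone
  · intro i j
    rw [SimpleGraph.comap_adj, h.adj]
    simp
  · intro q
    rw [hfib]
    refine le_trans ?_ (hu1 q)
    unfold base; split_ifs <;> omega
  · intro q
    rw [hfib]
    have h1 := hu1 q
    have h2 := hu2 q
    unfold base at h1
    constructor
    · intro hs; rw [if_pos hs] at h1; exact h1
    · intro h3; exact (h.size q).2 (le_trans h3 h2)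

noncomputable def Dset (P : HerProp) {k : ℕ} (H : Fin k → Fin k → Prop) (s : Fin k → Prop) :
    LowerSet (Fin k → ℕ) where
  carrier := {t | ∃ (n : ℕ) (G : SimpleGraph (Fin n)) (β : Fin n → Fin k),
    G ∈ P.mem n ∧ Pres H s G β ∧ ∀ q, fib β q = t q + base s q}
  lower' := by
    rintro t t' htt ⟨n, G, β, hG, hp, hf⟩
    refine sub_pres hG hp (fun q => t' q + base s q) (fun q => Nat.le_add_left _ _) (fun q => ?_)
    rw [hf]
    exact Nat.add_le_add_right (htt q) _

/-- graphs in `P_n` of type `(k, H, s)` -/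
def Acl (P : HerProp) {k : ℕ} (H : Fin k → Fin k → Prop) (s : Fin k → Prop) (n : ℕ) :
    Set (SimpleGraph (Fin n)) :=
  {G | G ∈ P.mem n ∧ Canon k H s ∧ ∃ β, Pres H s G β}

lemma Acl_card (P : HerProp) {k : ℕ} (H : Fin k → Fin k → Prop) (s : Fin k → Prop)
    (hc : Canon k H s) (n : ℕ) (hn : ∑ q, base s q ≤ n) :
    (Acl P H s n).ncard = cnt (Dset P H s) (n - ∑ q, base s q) := by
  classical
  let g : SimpleGraph (Fin n) → (Fin k → ℕ) := fun G q =>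
    (univ.filter (fun i : Fin n => bl G i = (q : ℕ))).card - base s q
  have hg : ∀ G β, Pres H s G β → ∀ q, g G q + base s q = fib β q := by
    intro G β hp q
    have e : (univ.filter (fun i : Fin n => bl G i = (q : ℕ))).card = fib β q := by
      unfold fib
      congr 1
      ext i
      simp only [mem_filter, mem_univ, true_and]
      rw [← pres_bl' hc hp i, Fin.ext_iff]
    have := base_le hp q
    show _ - _ + _ = _
    rw [e]; omega
  have hinj : Set.InjOn g (Acl P H s n) := by
    rintro G ⟨-, -, β, hp⟩ G' ⟨-, -, β', hp'⟩ hgg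
    have hβ : β = β' := mono_eq_of_fib hp.mono hp'.mono (fun q => by
      rw [← hg G β hp, ← hg G' β' hp', hgg])
    subst hβ
    ext i j
    rw [hp.adj, hp'.adj]
  rw [← Set.ncard_image_of_injOn hinj]
  unfold cnt
  congr 1
  ext t
  constructor
  · rintro ⟨G, ⟨hG, -, β, hp⟩, rfl⟩
    refine ⟨⟨n, G, β, hG, hp, fun q => (hg G β hp q).symm⟩, ?_⟩
    have h1 := sum_fib β
    simp only [← hg G β hp, Finset.sum_add_distrib] at h1
    omega
  · rintro ⟨⟨n', G, β, hG, hp, hf⟩, hs⟩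
    have h1 := sum_fib β
    simp only [hf, Finset.sum_add_distrib] at h1
    obtain rfl : n' = n := by omega
    refine ⟨G, ⟨hG, hc, β, hp⟩, ?_⟩
    funext q
    have h2 := hg G β hp q
    have h3 := hf q
    omega

lemma Acl_EP (P : HerProp) {k : ℕ} (H : Fin k → Fin k → Prop) (s : Fin k → Prop) :
    EP (fun n => ((Acl P H s n).ncard : ℤ)) := by
  by_cases hc : Canon k H s
  · refine EP_congr (∑ q, base s q) (fun n hn => ?_)
      (EP_shift (∑ q, base s q) (cnt_EP k (Dset P H s)))
    beta_reduce
    rw [Acl_card P H s hc n hn]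
  · refine EP_congr 0 (fun n _ => ?_) EP_zero
    have : Acl P H s n = ∅ := by
      ext G
      simp [Acl, hc]
    rw [this]; simp

lemma speed_EP (P : HerProp) (m : ℕ) (hm : speed P m < genFib 2 m) :
    EP (fun n => (speed P n : ℤ)) := by
  classical
  obtain ⟨K, hK⟩ := few_breaks m
  let ι := Σ k : Fin (K + 1), (Fin k → Fin k → Prop) × (Fin k → Prop)
  have hE : EP (fun n => ∑ τ : ι, ((Acl P τ.2.1 τ.2.2 n).ncard : ℤ)) :=
    EP_sum univ (fun (τ : ι) n => ((Acl P τ.2.1 τ.2.2 n).ncard : ℤ))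
      (fun τ _ => Acl_EP P τ.2.1 τ.2.2)
  refine EP_congr 1 (fun n hn => ?_) hE
  have e : P.mem n = ((univ : Finset ι).biUnion (fun τ => (Acl P τ.2.1 τ.2.2 n).toFinset) :
      Finset (SimpleGraph (Fin n))) := by
    ext G
    simp only [coe_biUnion, Set.mem_iUnion, Set.coe_toFinset, mem_coe, mem_univ]
    constructor
    · intro hG
      obtain ⟨H, s, β, hc, hp⟩ := exists_pres (by omega) G
      have hlt : bl G (n - 1) + 1 < K + 1 := by
        have := hK P hm n G hG ((Finset.range (n - 1)).filter (fun j => brk G j))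
          (fun i hi => (Finset.mem_filter.1 hi).2)
        unfold bl
        omega
      exact ⟨⟨⟨bl G (n - 1) + 1, hlt⟩, H, s⟩, trivial, hG, hc, β, hp⟩
    · rintro ⟨τ, -, hG, -⟩
      exact hG
  unfold speed
  rw [e, Set.ncard_coe_finset, Finset.card_biUnion]
  · push_cast
    apply Finset.sum_congr rfl
    intro τ _
    rw [Set.ncard_eq_toFinset_card']
  · rintro ⟨k, H, s⟩ _ ⟨k', H', s'⟩ _ hne
    rw [Function.onFun, Finset.disjoint_left]
    intro G h1 h2
    rw [Set.mem_toFinset] at h1 h2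
    obtain ⟨-, hc, β, hp⟩ := h1
    obtain ⟨-, hc', β', hp'⟩ := h2
    obtain rfl : k = k' :=
      Fin.ext (le_antisymm (pres_k_le hc hp hc' hp') (pres_k_le hc' hp' hc hp))
    obtain ⟨h3, h4⟩ := pres_unique hc hp hc' hp'
    apply hne
    simp only at h3 h4
    rw [h3, h4]

/-- **Theorem (exact polynomial speed).**  If `|P_m| < F_m` for some `m`, then there are
`K, N` and integers `a_0, …, a_K` with `|P_n| = Σ_{i=0}^K a_i·C(n,i)` for all `n ≥ N`. -/
theorem eventually_polynomial_speed (P : HerProp) (m : ℕ) (hm : speed P m < genFib 2 m) :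
    ∃ (K N : ℕ) (a : ℕ → ℤ), ∀ n : ℕ, N ≤ n →
      (speed P n : ℤ) = ∑ i ∈ Finset.range (K + 1), a i * (n.choose i : ℤ) := by
  obtain ⟨d, hd⟩ := speed_EP P m hm
  obtain ⟨N, a, h⟩ := Dz_poly (d + 1) _ (Dz_succ _ _ hd)
  exact ⟨d, N, a, h⟩
end
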